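/- arXiv:1012.3504 — 4 statements merged into one kernel-verified Lean document; each statement's English description precedes it below -/
import Mathlib

section
/- A connected graph G of order n ≥ 290 with minimum degree δ ≥ √(n−1) − 1 satisfies rvc(G) ≤ 3n/(δ+1) + 5. -/
open SimpleGraph

/-- A coloring `c` is a rainbow vertex-coloring witness with `k` colors: any two vertices are
joined by a path whose internal vertices have distinct colors, all among the first `k` colors. -/
def IsRainbowVColoring {V : Type*} (G : SimpleGraph V) (c : V → ℕ) (k : ℕ) : Prop :=
  ∀ u v : V, ∃ p : G.Walk u v, p.IsPath ∧ (p.support.tail.dropLast.map c).Nodup ∧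
    ∀ w ∈ p.support.tail.dropLast, c w < k

/-- The rainbow vertex-connection number. -/
noncomputable def rvc {V : Type*} (G : SimpleGraph V) : ℕ :=
  sInf {k : ℕ | ∃ c : V → ℕ, IsRainbowVColoring G c k}

/-- A set of vertices any two of which are joined by a walk inside the set. -/
def WalkConnected {V : Type*} (G : SimpleGraph V) (D : Finset V) : Prop :=
  ∀ s ∈ D, ∀ t ∈ D, ∃ p : G.Walk s t, ∀ x ∈ p.support, x ∈ D

theorem WalkConnected.insert_of_adj {V : Type*} [DecidableEq V] {G : SimpleGraph V} {D : Finset V}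
    (hD : WalkConnected G D) {d x : V} (hd : d ∈ D) (hx : G.Adj d x) :
    WalkConnected G (insert x D) := by
  have key : ∀ t ∈ D, ∃ p : G.Walk x t, ∀ y ∈ p.support, y ∈ insert x D := by
    intro t ht
    obtain ⟨p, hp⟩ := hD d hd t ht
    exact ⟨.cons hx.symm p, by simp only [Walk.support_cons, List.mem_cons]; grind⟩
  intro s hs t ht
  rw [Finset.mem_insert] at hs ht
  rcases hs with rfl | hs <;> rcases ht with rfl | ht
  · exact ⟨.nil, by simp⟩
  · exact key t ht
  · obtain ⟨p, hp⟩ := key s hs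
    exact ⟨p.reverse, by simpa using hp⟩
  · obtain ⟨p, hp⟩ := hD s hs t ht
    exact ⟨p, fun y hy => Finset.mem_insert_of_mem (hp y hy)⟩

/-- The vertices at distance at most one from `D`. -/
noncomputable def closedNbhd {V : Type*} [Fintype V] (G : SimpleGraph V) (D : Finset V) :
    Finset V := by
  classical exact Finset.univ.filter fun x => ∃ d ∈ D, d = x ∨ G.Adj d x

theorem mem_closedNbhd {V : Type*} [Fintype V] {G : SimpleGraph V} {D : Finset V} {x : V} :
    x ∈ closedNbhd G D ↔ ∃ d ∈ D, d = x ∨ G.Adj d x := by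
  simp [closedNbhd]

theorem closedNbhd_mono {V : Type*} [Fintype V] {G : SimpleGraph V} {D E : Finset V}
    (h : D ⊆ E) : closedNbhd G D ⊆ closedNbhd G E := by
  intro x
  simp only [mem_closedNbhd]
  exact fun ⟨d, hd, hx⟩ => ⟨d, h hd, hx⟩

theorem minDegree_add_one_le_card_closedNbhd_singleton {V : Type*} [Fintype V] (G : SimpleGraph V)
    [DecidableRel G.Adj] (w : V) : G.minDegree + 1 ≤ (closedNbhd G {w}).card := by
  classical
  have h : closedNbhd G {w} = insert w (G.neighborFinset w) := by
    ext x; simp [mem_closedNbhd, eq_comm]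
  rw [h, Finset.card_insert_of_notMem (by simp), card_neighborFinset_eq_degree]
  exact Nat.add_le_add_right (G.minDegree_le_degree w) 1

/-- Enlarging `D` to `E ∋ w` adds the part of the closed neighborhood of `w` missed by `D`. -/
theorem card_closedNbhd_add_le {V : Type*} [Fintype V] [DecidableEq V] {G : SimpleGraph V}
    {D E : Finset V} {w : V} (hDE : D ⊆ E) (hw : w ∈ E) :
    (closedNbhd G D).card + (closedNbhd G {w} \ closedNbhd G D).card
      ≤ (closedNbhd G E).card := by
  rw [← Finset.card_union_of_disjoint Finset.disjoint_sdiff]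
  refine Finset.card_le_card (Finset.union_subset (closedNbhd_mono hDE) ?_)
  exact Finset.sdiff_subset.trans (closedNbhd_mono (by simpa using hw))

/-- A connected graph of minimum degree `m - 1` has a connected set `D` of at most `3n / m` vertices
within distance two of every vertex, such that every vertex not dominated by `D` has more than
`m / 3` neighbors that are. -/
theorem exists_walkConnected_dominating {V : Type*} [Fintype V] [DecidableEq V]
    {G : SimpleGraph V} [DecidableRel G.Adj] (hG : G.Connected) :
    ∃ D : Finset V, D.Nonempty ∧ WalkConnected G D ∧
      D.card * (G.minDegree + 1) ≤ 3 * Fintype.card V ∧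
      ∀ w ∉ closedNbhd G D,
        G.minDegree + 1 < 3 * (closedNbhd G {w} ∩ closedNbhd G D).card := by
  classical
  let S : Finset (Finset V) := Finset.univ.filter fun D => D.Nonempty ∧ WalkConnected G D ∧
    D.card * (G.minDegree + 1) ≤ 3 * (closedNbhd G D).card
  obtain ⟨v⟩ := hG.nonempty
  have hS : S.Nonempty := by
    refine ⟨{v}, ?_⟩
    simp only [S, Finset.mem_filter, Finset.mem_univ, true_and]
    refine ⟨by simp, ?_, ?_⟩
    · intro s hs t ht
      obtain rfl := Finset.mem_singleton.1 hs
      obtain rfl := Finset.mem_singleton.1 ht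
      exact ⟨.nil, by simp⟩
    · have := minDegree_add_one_le_card_closedNbhd_singleton G v
      rw [Finset.card_singleton]; omega
  obtain ⟨D, hDS, hmax⟩ := S.exists_max_image (fun D => (closedNbhd G D).card) hS
  simp only [S, Finset.mem_filter, Finset.mem_univ, true_and] at hDS hmax
  obtain ⟨hne, hconn, hcard⟩ := hDS
  have hself : ∀ d ∈ D, d ∈ closedNbhd G D := fun d hd => mem_closedNbhd.2 ⟨d, hd, .inl rfl⟩
  have hnbhd : ∀ x ∈ closedNbhd G D, ∀ y ∉ closedNbhd G D, G.Adj x y →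
      ∃ d ∈ D, G.Adj d x := by
    intro x hx y hy hxy
    obtain ⟨d, hd, rfl | h⟩ := mem_closedNbhd.1 hx
    · exact absurd (mem_closedNbhd.2 ⟨d, hd, .inr hxy⟩) hy
    · exact ⟨d, hd, h⟩
  have hpos : ∀ w ∉ closedNbhd G D, 0 < (closedNbhd G {w} \ closedNbhd G D).card := by
    intro w hw
    exact Finset.card_pos.2 ⟨w, Finset.mem_sdiff.2
      ⟨mem_closedNbhd.2 ⟨w, by simp, .inl rfl⟩, hw⟩⟩
  have hfew : ∀ x ∈ closedNbhd G D, ∀ w ∉ closedNbhd G D, G.Adj x w →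
      3 * (closedNbhd G {w} \ closedNbhd G D).card < 2 * (G.minDegree + 1) := by
    intro x hx w hw hxw
    obtain ⟨d, hd, hdx⟩ := hnbhd x hx w hw hxw
    by_contra! hlt
    have hE := card_closedNbhd_add_le (G := G) (D := D) (E := insert w (insert x D)) (w := w)
      (by grind) (by grind)
    have h1 : (insert w (insert x D)).card ≤ D.card + 2 :=
      (Finset.card_insert_le _ _).trans (Nat.add_le_add_right (Finset.card_insert_le _ _) 1)
    have := hmax (insert w (insert x D)) ⟨by simp,
      (hconn.insert_of_adj hd hdx).insert_of_adj (Finset.mem_insert_self _ _) hxw, by nlinarith⟩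
    have := hpos w hw
    omega
  have hnear : ∀ w, w ∉ closedNbhd G D → ∃ x ∈ closedNbhd G D, G.Adj x w := by
    by_contra! hcon
    obtain ⟨w, hw, hwx⟩ := hcon
    obtain ⟨d, hd⟩ := hne
    let T : Set V := {y | y ∈ closedNbhd G (closedNbhd G D)}
    have hdT : d ∈ T := mem_closedNbhd.2 ⟨d, hself d hd, .inl rfl⟩
    have hwT : w ∉ T := by
      intro h
      obtain ⟨x, hx, rfl | h⟩ := mem_closedNbhd.1 h
      · exact hw hx
      · exact hwx x hx h
    obtain ⟨p⟩ := hG.preconnected d w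
    obtain ⟨e, -, heT, hz⟩ := p.exists_boundary_dart T hdT hwT
    obtain ⟨⟨b, z⟩, hbz⟩ := e
    dsimp only at heT hz hbz
    have hz' : ∀ x ∈ closedNbhd G D, x ≠ z ∧ ¬ G.Adj x z := by
      intro x hx
      exact ⟨fun h => hz (mem_closedNbhd.2 ⟨x, hx, .inl h⟩),
        fun h => hz (mem_closedNbhd.2 ⟨x, hx, .inr h⟩)⟩
    have hb : b ∉ closedNbhd G D := fun h => (hz' b h).2 hbz
    obtain ⟨a, ha, rfl | hab⟩ := mem_closedNbhd.1 heT
    · exact hb ha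
    obtain ⟨d', hd', hda⟩ := hnbhd a ha b hb hab
    have hE := card_closedNbhd_add_le (G := G) (D := D)
      (E := insert z (insert b (insert a D))) (w := z) (by grind) (by grind)
    have hdisj : closedNbhd G {z} \ closedNbhd G D = closedNbhd G {z} := by
      rw [Finset.sdiff_eq_self_iff_disjoint, Finset.disjoint_left]
      intro y hy hyD
      obtain ⟨z', hz'', h⟩ := mem_closedNbhd.1 hy
      obtain rfl := Finset.mem_singleton.1 hz''
      rcases h with rfl | h
      · exact (hz' _ hyD).1 rfl
      · exact (hz' _ hyD).2 h.symm
    rw [hdisj] at hE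
    have hm := minDegree_add_one_le_card_closedNbhd_singleton G z
    have h1 : (insert z (insert b (insert a D))).card ≤ D.card + 3 := by
      have h1 := Finset.card_insert_le z (insert b (insert a D))
      have h2 := Finset.card_insert_le b (insert a D)
      have h3 := Finset.card_insert_le a D
      omega
    have := hmax (insert z (insert b (insert a D))) ⟨by simp,
      ((hconn.insert_of_adj hd' hda).insert_of_adj (Finset.mem_insert_self _ _) hab).insert_of_adj
        (Finset.mem_insert_self _ _) hbz, by nlinarith⟩
    omega
  refine ⟨D, hne, hconn, hcard.trans (Nat.mul_le_mul_left 3 (Finset.card_le_univ _)), ?_⟩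
  intro w hw
  obtain ⟨x, hx, hxw⟩ := hnear w hw
  have h1 := hfew x hx w hw hxw
  have h2 := minDegree_add_one_le_card_closedNbhd_singleton G w
  have h3 := Finset.card_sdiff_add_card_inter (closedNbhd G {w}) (closedNbhd G D)
  omega

open Finset in
theorem card_monochromatic_le {V : Type*} [Fintype V] [DecidableEq V] {k d : ℕ}
    {A : Finset V} (hA : d < #A) :
    #{f : V → Fin k | ∀ x ∈ A, ∀ y ∈ A, f x = f y} * k ^ d ≤ k ^ Fintype.card V := by
  obtain ⟨a, ha⟩ : A.Nonempty := card_pos.1 (by omega)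
  obtain ⟨B, hB, hBd⟩ := exists_subset_card_eq (s := A.erase a) (n := d)
    (by rw [card_erase_of_mem ha]; omega)
  have hinj : #{f : V → Fin k | ∀ x ∈ A, ∀ y ∈ A, f x = f y}
      ≤ #(univ : Finset ({x // x ∉ B} → Fin k)) := by
    refine card_le_card_of_injOn (fun f x => f x) (by simp) ?_
    intro f hf g hg hfg
    simp only [coe_filter, mem_univ, true_and, Set.mem_ofPred_eq] at hf hg
    have hout : ∀ x ∉ B, f x = g x := fun x hx => congrFun hfg ⟨x, hx⟩
    have haB : a ∉ B := fun h => by simpa using hB h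
    funext x
    by_cases hx : x ∈ B
    · have hxA := mem_of_mem_erase (hB hx)
      rw [hf x hxA a ha, hg x hxA a ha, hout a haB]
    · exact hout x hx
  refine (Nat.mul_le_mul_right _ hinj).trans_eq ?_
  have hle : d ≤ Fintype.card V := hBd ▸ card_le_univ B
  rw [card_univ, Fintype.card_fun, Fintype.card_fin, Fintype.card_subtype_compl,
    Fintype.card_coe, hBd, ← pow_add, Nat.sub_add_cancel hle]

open Finset in
/-- If fewer than `k ^ d` sets have more than `d` elements each, some `k`-coloring makes none of
them monochromatic. -/
theorem exists_coloring_not_monochromatic {V : Type*} [Fintype V] [DecidableEq V] {k d : ℕ}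
    (hk : 0 < k) (I : Finset V) (A : V → Finset V) (hA : ∀ i ∈ I, d < #(A i))
    (hI : #I < k ^ d) :
    ∃ f : V → Fin k, ∀ i ∈ I, ∃ x ∈ A i, ∃ y ∈ A i, f x ≠ f y := by
  by_contra! hcon
  have hcover : (univ : Finset (V → Fin k)) ⊆
      I.biUnion fun i => {f : V → Fin k | ∀ x ∈ A i, ∀ y ∈ A i, f x = f y} := by
    intro f _
    simpa using hcon f
  have h1 := (card_le_card hcover).trans card_biUnion_le
  rw [card_univ, Fintype.card_fun, Fintype.card_fin] at h1
  have h2 : k ^ Fintype.card V * k ^ d ≤ #I * k ^ Fintype.card V := by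
    refine (Nat.mul_le_mul_right _ h1).trans ?_
    rw [sum_mul]
    exact (sum_le_sum fun i hi => card_monochromatic_le (hA i hi)).trans_eq (by simp)
  have h3 : 0 < k ^ Fintype.card V := by positivity
  nlinarith

/-- A walk whose vertices other than its ends lie in a set with distinct colors can be shortened to
a path with distinctly colored internal vertices. -/
theorem exists_rainbow_path_of_walk {V : Type*} {G : SimpleGraph V} {c : V → ℕ} {k : ℕ}
    {u v : V} {T : Set V} (hT : Set.InjOn c T) (hk : ∀ x ∈ T, c x < k) (p : G.Walk u v)
    (hp : ∀ x ∈ p.support, x = u ∨ x = v ∨ x ∈ T) :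
    ∃ p : G.Walk u v, p.IsPath ∧ (p.support.tail.dropLast.map c).Nodup ∧
      ∀ w ∈ p.support.tail.dropLast, c w < k := by
  classical
  have hpath := p.bypass_isPath
  have hnd := hpath.support_nodup
  have hmem : ∀ x ∈ p.bypass.support.tail.dropLast, x ∈ T := by
    intro x hx
    have hxt := List.dropLast_subset _ hx
    have hxu : x ≠ u := by
      rintro rfl
      rw [← Walk.cons_tail_support, List.nodup_cons] at hnd
      exact hnd.1 hxt
    have hxv : x ≠ v := by
      rintro rfl
      have hne : p.bypass.support.tail ≠ [] := List.ne_nil_of_mem hxt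
      have hlast : p.bypass.support.tail.getLast hne = x := by
        rw [List.getLast_tail]; simp
      have hd := hnd.tail
      rw [← List.dropLast_append_getLast hne, hlast, List.nodup_append] at hd
      exact hd.2.2 x hx x (by simp) rfl
    have := hp x (p.support_bypass_subset_support (List.mem_of_mem_tail hxt))
    tauto
  refine ⟨p.bypass, hpath, ?_, fun w hw => hk w (hmem w hw)⟩
  refine List.Nodup.map_on (fun x hx y hy h => hT (hmem x hx) (hmem y hy) h) ?_
  exact hnd.tail.sublist (List.dropLast_sublist _)

/-- If every vertex not dominated by the connected set `D` has dominated neighbors of two different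
colors, then coloring `D` injectively with new colors gives a rainbow vertex-coloring. -/
theorem rvc_le_card_add {V : Type*} [Fintype V] [DecidableEq V] {G : SimpleGraph V}
    {D : Finset V} {k : ℕ} (hD : WalkConnected G D) (f : V → Fin k)
    (hf : ∀ w ∉ closedNbhd G D, ∃ x ∈ closedNbhd G {w} ∩ closedNbhd G D,
      ∃ y ∈ closedNbhd G {w} ∩ closedNbhd G D, f x ≠ f y) :
    rvc G ≤ D.card + k := by
  have key : ∀ (u : V) (j : Option (Fin k)), ∃ x, (x ∈ D ∨ some (f x) ≠ j) ∧ ∃ s ∈ D,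
      ∃ p : G.Walk u s, ∀ z ∈ p.support, z = u ∨ z = x ∨ z ∈ D := by
    intro u j
    by_cases hu : u ∈ closedNbhd G D
    · obtain ⟨d, hd, rfl | h⟩ := mem_closedNbhd.1 hu
      · exact ⟨d, .inl hd, d, hd, .nil, by simp⟩
      · exact ⟨d, .inl hd, d, hd, .cons h.symm .nil, by simp⟩
    · obtain ⟨x, hx, hxj⟩ : ∃ x ∈ closedNbhd G {u} ∩ closedNbhd G D, some (f x) ≠ j := by
        obtain ⟨x, hx, y, hy, hxy⟩ := hf u hu
        by_cases h : some (f x) = j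
        · exact ⟨y, hy, fun h' => hxy (Option.some_injective _ (h.trans h'.symm))⟩
        · exact ⟨x, hx, h⟩
      obtain ⟨hx1, hx2⟩ := Finset.mem_inter.1 hx
      obtain ⟨u', hu', hux⟩ := mem_closedNbhd.1 hx1
      obtain rfl := Finset.mem_singleton.1 hu'
      obtain rfl | hux := hux
      · exact absurd hx2 hu
      obtain ⟨d, hd, rfl | h⟩ := mem_closedNbhd.1 hx2
      · exact ⟨d, .inl hd, d, hd, .cons hux .nil, by simp⟩
      · exact ⟨x, .inr hxj, d, hd, .cons hux (.cons h.symm .nil), by simp_all⟩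
  let e : V → ℕ := fun x => if hx : x ∈ D then D.equivFin ⟨x, hx⟩ else 0
  have helt : ∀ x ∈ D, e x < D.card := fun x hx => by simp [e, hx]
  have heinj : ∀ x ∈ D, ∀ y ∈ D, e x = e y → x = y := by
    intro x hx y hy h
    simpa [e, hx, hy, Fin.val_inj] using h
  let c : V → ℕ := fun x => if x ∈ D then e x else D.card + f x
  refine Nat.sInf_le ⟨c, fun u v => ?_⟩
  obtain ⟨x, -, s, hs, p, hp⟩ := key u none
  obtain ⟨y, hy, t, ht, q, hq⟩ := key v (some (f x))
  obtain ⟨r, hr⟩ := hD s hs t ht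
  refine exists_rainbow_path_of_walk (T := {z | z = x ∨ z = y ∨ z ∈ D}) ?_ ?_
    (p.append (r.append q.reverse)) ?_
  · intro a ha b hb hab
    have hval : ∀ z, some (f z) ≠ some (f x) → (f z : ℕ) ≠ f x :=
      fun z h h' => h (congrArg some (Fin.ext h'))
    simp only [Set.mem_ofPred_eq] at ha hb
    simp only [c] at hab
    grind
  · intro z _
    simp only [c]
    split_ifs with h
    · exact (helt z h).trans_le (Nat.le_add_right _ _)
    · exact Nat.add_lt_add_left (f z).isLt _
  · intro z hz
    simp only [Walk.mem_support_append_iff, Walk.support_reverse, List.mem_reverse] at hz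
    simp only [Set.mem_ofPred_eq]
    grind

theorem sq_lt_five_pow {d : ℕ} (hd : 5 ≤ d) : (3 * d + 2) ^ 2 + 1 < 5 ^ d := by
  induction d, hd using Nat.le_induction with
  | base => norm_num
  | succ d hd ih => rw [pow_succ 5]; nlinarith

theorem stmt_9 {V : Type*} [Fintype V] (G : SimpleGraph V) [DecidableRel G.Adj]
    (hG : G.Connected) (hn : 290 ≤ Fintype.card V)
    (hδ : Real.sqrt (Fintype.card V - 1) - 1 ≤ (G.minDegree : ℝ)) :
    (rvc G : ℝ) ≤ 3 * (Fintype.card V : ℝ) / (G.minDegree + 1) + 5 := by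
  classical
  obtain ⟨D, -, hD, hcard, hdom⟩ := exists_walkConnected_dominating hG
  have hsq : Fintype.card V ≤ (G.minDegree + 1) ^ 2 + 1 := by
    have h := (Real.sqrt_le_left (by positivity)).1 (sub_le_iff_le_add.1 hδ)
    rw [sub_le_iff_le_add] at h
    exact_mod_cast h
  have hm : 17 ≤ G.minDegree + 1 := by
    by_contra! h
    nlinarith
  have hlt : Fintype.card V < 5 ^ ((G.minDegree + 1) / 3) := by
    have h1 := sq_lt_five_pow (d := (G.minDegree + 1) / 3) (by omega)
    have h2 : G.minDegree + 1 ≤ 3 * ((G.minDegree + 1) / 3) + 2 := by omega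
    have h3 := Nat.pow_le_pow_left h2 2
    omega
  obtain ⟨f, hf⟩ := exists_coloring_not_monochromatic (k := 5) (d := (G.minDegree + 1) / 3)
    (by norm_num) (closedNbhd G D)ᶜ (fun w => closedNbhd G {w} ∩ closedNbhd G D)
    (fun w hw => by have := hdom w (Finset.mem_compl.1 hw); omega)
    ((Finset.card_le_univ _).trans_lt hlt)
  have hrvc := rvc_le_card_add hD f fun w hw => hf w (Finset.mem_compl.2 hw)
  have hpos : (0 : ℝ) < G.minDegree + 1 := by positivity
  have hDle : (D.card : ℝ) ≤ 3 * (Fintype.card V : ℝ) / (G.minDegree + 1) := by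
    rw [le_div_iff₀ hpos]
    exact_mod_cast hcard
  have : (rvc G : ℝ) ≤ D.card + 5 := by exact_mod_cast hrvc
  linarith
end

section
/- A connected graph G of order n with minimum degree δ, 6 ≤ δ ≤ 15, has rvc(G) ≤ 4n/(δ+1) + C(δ), where C(δ) = exp((3 log(δ³+2δ²+3) − 3(log 3 − 1))/(δ−3)) − 2. -/
open SimpleGraph

namespace SimpleGraph

variable {V : Type*} {G : SimpleGraph V}

/-- Any two vertices of `S` are joined by a walk inside `S`. -/
def WalkConnected (G : SimpleGraph V) (S : Finset V) : Prop :=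
  ∀ s ∈ S, ∀ t ∈ S, ∃ p : G.Walk s t, ∀ w ∈ p.support, w ∈ S

lemma walkConnected_singleton (v : V) : G.WalkConnected {v} := by
  intro s hs t ht
  rw [Finset.mem_singleton] at hs ht
  subst hs ht
  exact ⟨Walk.nil, by simp⟩

lemma WalkConnected.insert [DecidableEq V] {S : Finset V} (hS : G.WalkConnected S) {x s : V}
    (hs : s ∈ S) (hx : G.Adj x s) : G.WalkConnected (Insert.insert x S) := by
  have key : ∀ t ∈ S, ∃ p : G.Walk x t, ∀ w ∈ p.support, w ∈ Insert.insert x S := by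
    intro t ht
    obtain ⟨p, hp⟩ := hS s hs t ht
    refine ⟨Walk.cons hx p, ?_⟩
    intro w hw
    rw [Walk.support_cons, List.mem_cons] at hw
    rcases hw with rfl | hw
    · exact Finset.mem_insert_self _ _
    · exact Finset.mem_insert_of_mem (hp w hw)
  intro a ha b hb
  rcases Finset.mem_insert.1 ha with rfl | ha' <;> rcases Finset.mem_insert.1 hb with rfl | hb'
  · exact ⟨Walk.nil, by simp⟩
  · exact key b hb'
  · obtain ⟨p, hp⟩ := key a ha'
    exact ⟨p.reverse, by simpa [Walk.support_reverse] using hp⟩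
  · obtain ⟨p, hp⟩ := hS a ha' b hb'
    exact ⟨p, fun w hw => Finset.mem_insert_of_mem (hp w hw)⟩

/-- The vertices that neither lie in `S` nor have a neighbor in `S`. -/
noncomputable def undominated [Fintype V] (G : SimpleGraph V) (S : Finset V) : Finset V := by
  classical exact Finset.univ.filter fun v => v ∉ S ∧ ∀ s ∈ S, ¬ G.Adj v s

lemma mem_undominated [Fintype V] {S : Finset V} {v : V} :
    v ∈ G.undominated S ↔ v ∉ S ∧ ∀ s ∈ S, ¬ G.Adj v s := by
  simp [undominated]

lemma card_add_card_undominated_le [Fintype V] [DecidableEq V] {S S' R : Finset V} (h : S ⊆ S')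
    (hR : R ⊆ G.undominated S) (hR' : ∀ v ∈ R, v ∉ G.undominated S') :
    R.card + (G.undominated S').card ≤ (G.undominated S).card := by
  rw [← Finset.card_union_of_disjoint (Finset.disjoint_left.2 hR')]
  refine Finset.card_le_card (Finset.union_subset hR fun v hv => ?_)
  rw [mem_undominated] at hv ⊢
  exact ⟨fun hvS => hv.1 (h hvS), fun s hs => hv.2 s (h hs)⟩

/-- A colouring with `d + 1` colours separating the endpoints of prescribed pairs, when every vertex
is in at most `d` pairs. -/
lemma exists_coloring_separating_pairs {ι : Type*} [DecidableEq V] (I : Finset ι) (a b : ι → V)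
    (d : ℕ) (hab : ∀ i ∈ I, a i ≠ b i)
    (hd : ∀ x, (I.filter fun i => a i = x ∨ b i = x).card ≤ d) (T : Finset V) :
    ∃ c : V → ℕ, (∀ x, c x < d + 1) ∧ ∀ i ∈ I, a i ∈ T → b i ∈ T → c (a i) ≠ c (b i) := by
  induction T using Finset.induction_on with
  | empty => exact ⟨fun _ => 0, by simp, by simp⟩
  | insert x T hx ih =>
    obtain ⟨c, hc, hcT⟩ := ih
    obtain ⟨k, hk, hkn⟩ : ∃ k ∈ Finset.range (d + 1),
        k ∉ (I.filter fun i => a i = x ∨ b i = x).image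
          fun i => if a i = x then c (b i) else c (a i) := by
      apply Finset.exists_mem_notMem_of_card_lt_card
      calc _ ≤ _ := Finset.card_image_le
        _ ≤ d := hd x
        _ < _ := by simp
    refine ⟨Function.update c x k, ?_, ?_⟩
    · intro y
      by_cases hy : y = x
      · subst hy; simpa using hk
      · simpa [Function.update_of_ne hy] using hc y
    · intro i hi ha hb
      have hne := hab i hi
      by_cases hax : a i = x
      · have hbx : b i ≠ x := fun h => hne (hax.trans h.symm)
        rw [hax, Function.update_self, Function.update_of_ne hbx]
        intro h
        exact hkn (Finset.mem_image.2 ⟨i, by simp [hi, hax], by simp [hax, h]⟩)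
      · by_cases hbx : b i = x
        · rw [hbx, Function.update_self, Function.update_of_ne hax]
          intro h
          exact hkn (Finset.mem_image.2 ⟨i, by simp [hi, hbx], by simp [hax, h]⟩)
        · rw [Function.update_of_ne hax, Function.update_of_ne hbx]
          exact hcT i hi (Finset.mem_of_mem_insert_of_ne ha hax)
            (Finset.mem_of_mem_insert_of_ne hb hbx)

lemma exists_walkConnected_two_step_dominating [Fintype V] [DecidableRel G.Adj] [DecidableEq V]
    (hG : G.Connected) (hδ1 : 6 ≤ G.minDegree) (hδ2 : G.minDegree ≤ 15) :
    ∃ S : Finset V, G.WalkConnected S ∧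
      (G.minDegree + 1) * (S.card + 2) ≤ 4 * Fintype.card V ∧
      (∀ x, x ∉ G.undominated S →
        ((G.undominated S).filter fun v => G.Adj v x).card ≤ 3) ∧
      ∀ v ∈ G.undominated S, ∃ a b, a ≠ b ∧ G.Adj v a ∧ G.Adj v b ∧
        a ∉ G.undominated S ∧ b ∉ G.undominated S := by
  classical
  set δ := G.minDegree with hδ
  set P : Finset V → Prop := fun S => S.Nonempty ∧ G.WalkConnected S ∧
    (δ + 1) * (S.card + 2) + 4 * (G.undominated S).card ≤ 4 * Fintype.card V with hP
  have hdeg : ∀ v, δ ≤ (G.neighborFinset v).card := fun v => G.minDegree_le_degree v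
  obtain ⟨v₀⟩ := hG.nonempty
  have hP₀ : P {v₀} := by
    refine ⟨by simp, walkConnected_singleton v₀, ?_⟩
    have hd : (insert v₀ (G.neighborFinset v₀)).card + (G.undominated {v₀}).card ≤
        Fintype.card V := by
      rw [← Finset.card_union_of_disjoint]
      · exact Finset.card_le_univ _
      · rw [Finset.disjoint_left]
        intro v hv hv'
        rw [mem_undominated] at hv'
        rcases Finset.mem_insert.1 hv with rfl | hv
        · simp at hv'
        · exact hv'.2 v₀ (by simp) ((G.mem_neighborFinset _ _).1 hv).symm
    rw [Finset.card_insert_of_notMem (by simp)] at hd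
    have := hdeg v₀
    rw [Finset.card_singleton]
    lia
  obtain ⟨S, hS, hmax⟩ := Finset.exists_max_image (Finset.univ.filter P) Finset.card
    ⟨{v₀}, by simpa using hP₀⟩
  obtain ⟨hSn, hSc, hScard⟩ : P S := by simpa using hS
  have hmax' : ∀ S', G.WalkConnected S' → S ⊆ S' → S.card < S'.card →
      (δ + 1) * (S'.card + 2) + 4 * (G.undominated S').card ≤ 4 * Fintype.card V → False := by
    intro S' h1 h2 h3 h4
    exact absurd (hmax S' (by simpa using ⟨hSn.mono h2, h1, h4⟩)) (by lia)
  have hnear : ∀ x, x ∉ G.undominated S → x ∉ S → ∃ s ∈ S, G.Adj x s := by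
    intro x hx hxS
    simpa [mem_undominated, hxS] using hx
  have hnotS : ∀ v ∈ G.undominated S, ∀ a, G.Adj v a → a ∉ S := fun v hv a ha haS =>
    (mem_undominated.1 hv).2 a haS ha
  have hdist : ∀ v ∈ G.undominated S, ∃ a, G.Adj v a ∧ a ∉ G.undominated S := by
    by_contra! hcon
    obtain ⟨z, hz, hzn⟩ := hcon
    set Q : Set V := {v | v ∈ G.undominated S ∧ ∀ a, G.Adj v a → a ∈ G.undominated S} with hQ
    obtain ⟨s, hs⟩ := hSn
    have hsU : s ∉ G.undominated S := fun h => (mem_undominated.1 h).1 hs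
    obtain ⟨p⟩ := hG.preconnected z s
    obtain ⟨d, -, hd1, hd2⟩ := p.exists_boundary_dart Q ⟨hz, hzn⟩ (fun h => hsU h.1)
    obtain ⟨⟨z', w⟩, hzw⟩ := d
    dsimp only at hd1 hd2
    change G.Adj z' w at hzw
    have hwU := hd1.2 w hzw
    obtain ⟨x, hwx, hxU⟩ : ∃ x, G.Adj w x ∧ x ∉ G.undominated S := by
      by_contra! h
      exact hd2 ⟨hwU, h⟩
    have hxS := hnotS w hwU x hwx
    obtain ⟨t, ht, hxt⟩ := hnear x hxU hxS
    have hwS := (mem_undominated.1 hwU).1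
    have hzS := (mem_undominated.1 hd1.1).1
    have hzw' := hzw.ne
    have hwx' := hwx.ne
    have hzx' : z' ≠ x := fun h => hxU (h ▸ hd1.1)
    have hcard : (insert z' (insert w (insert x S))).card = S.card + 3 := by
      rw [Finset.card_insert_of_notMem, Finset.card_insert_of_notMem,
        Finset.card_insert_of_notMem hxS] <;> simp [*]
    have hsub : S ⊆ insert z' (insert w (insert x S)) := by
      intro y hy; simp [hy]
    have hle := card_add_card_undominated_le (G := G) (R := insert z' (G.neighborFinset z')) hsub
      (by
        intro y hy
        rcases Finset.mem_insert.1 hy with rfl | hy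
        · exact hd1.1
        · exact hd1.2 y ((G.mem_neighborFinset _ _).1 hy))
      (by
        intro y hy hy'
        rw [mem_undominated] at hy'
        rcases Finset.mem_insert.1 hy with rfl | hy
        · simp at hy'
        · exact hy'.2 z' (by simp) ((G.mem_neighborFinset _ _).1 hy).symm)
    rw [Finset.card_insert_of_notMem (by simp)] at hle
    have := hdeg z'
    refine hmax' _ (((hSc.insert ht hxt).insert (Finset.mem_insert_self _ _) hwx).insert
      (Finset.mem_insert_self _ _) hzw) hsub (by lia) ?_
    rw [hcard]
    nlinarith
  refine ⟨S, hSc, by lia, ?_, ?_⟩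
  · intro x hxU
    by_contra! hlt
    have hxS : x ∉ S := by
      intro hxS
      have : ((G.undominated S).filter fun v => G.Adj v x) = ∅ :=
        Finset.filter_eq_empty_iff.2 fun v hv => (mem_undominated.1 hv).2 x hxS
      simp [this] at hlt
    obtain ⟨t, ht, hxt⟩ := hnear x hxU hxS
    have hcard := Finset.card_insert_of_notMem hxS
    have hle := card_add_card_undominated_le (G := G) (Finset.subset_insert x S)
      (Finset.filter_subset (fun v => G.Adj v x) (G.undominated S))
      (by
        intro y hy hy'
        exact (mem_undominated.1 hy').2 x (by simp) (Finset.mem_filter.1 hy).2)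
    refine hmax' _ (hSc.insert ht hxt) (Finset.subset_insert x S) (by lia) ?_
    rw [hcard]
    nlinarith
  · intro v hv
    obtain ⟨x, hvx, hxU⟩ := hdist v hv
    by_contra! hcon
    have hxS := hnotS v hv x hvx
    obtain ⟨t, ht, hxt⟩ := hnear x hxU hxS
    have hvS := (mem_undominated.1 hv).1
    have hvx' := hvx.ne
    have hcard : (insert v (insert x S)).card = S.card + 2 := by
      rw [Finset.card_insert_of_notMem, Finset.card_insert_of_notMem hxS]
      simp [*]
    have hsub : S ⊆ insert v (insert x S) := by
      intro y hy; simp [hy]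
    have hle := card_add_card_undominated_le (G := G)
      (R := insert v ((G.neighborFinset v).erase x)) hsub
      (by
        intro y hy
        rcases Finset.mem_insert.1 hy with rfl | hy
        · exact hv
        · rw [Finset.mem_erase, mem_neighborFinset] at hy
          by_contra hyU
          exact hyU (hcon x y hy.1.symm hvx hy.2 hxU))
      (by
        intro y hy hy'
        rw [mem_undominated] at hy'
        rcases Finset.mem_insert.1 hy with rfl | hy
        · simp at hy'
        · rw [Finset.mem_erase, mem_neighborFinset] at hy
          exact hy'.2 v (by simp) hy.2.symm)
    rw [Finset.card_insert_of_notMem (by simp), Finset.card_erase_of_mem (by simpa using hvx)]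
      at hle
    have := hdeg v
    refine hmax' _ ((hSc.insert ht hxt).insert (Finset.mem_insert_self _ _) hvx) hsub (by lia) ?_
    rw [hcard]
    nlinarith [Nat.sub_add_cancel (show 1 ≤ (G.neighborFinset v).card by lia)]

lemma Walk.exists_isPath_rainbow {u v : V} (p : G.Walk u v) (c : V → ℕ) (k : ℕ)
    (hk : ∀ w, c w < k)
    (hc : ∀ x ∈ p.support, ∀ y ∈ p.support, x ≠ u → x ≠ v → y ≠ u → y ≠ v → c x = c y → x = y) :
    ∃ q : G.Walk u v, q.IsPath ∧ (q.support.tail.dropLast.map c).Nodup ∧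
      ∀ w ∈ q.support.tail.dropLast, c w < k := by
  classical
  have hq := p.bypass_isPath
  have hsub : ∀ w ∈ p.bypass.support, w ∈ p.support := fun w hw =>
    p.support_bypass_subset_support hw
  have hnd := hq.support_nodup
  have hu : ∀ w ∈ p.bypass.support.tail.dropLast, w ≠ u := by
    rintro w hw rfl
    rw [← Walk.cons_tail_support] at hnd
    exact (List.nodup_cons.1 hnd).1 (List.dropLast_subset _ hw)
  have hv : ∀ w ∈ p.bypass.support.tail.dropLast, w ≠ v := by
    rintro w hw rfl
    have h2 : p.bypass.support.dropLast ++ [w] = p.bypass.support := by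
      rw [← List.dropLast_append_getLast (Walk.support_ne_nil _), Walk.getLast_support]
      simp
    rw [← h2, List.nodup_append] at hnd
    rw [← List.tail_dropLast] at hw
    exact hnd.2.2 w (List.mem_of_mem_tail hw) w (by simp) rfl
  have hmem : ∀ w ∈ p.bypass.support.tail.dropLast, w ∈ p.support := fun w hw =>
    hsub w (List.mem_of_mem_tail (List.dropLast_subset _ hw))
  refine ⟨p.bypass, hq, ?_, fun w _ => hk w⟩
  refine List.Nodup.map_on (fun x hx y hy => ?_) ?_
  · exact hc x (hmem x hx) y (hmem y hy) (hu x hx) (hv x hx) (hu y hy) (hv y hy)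
  · exact (hnd.sublist (List.tail_sublist _)).sublist (List.dropLast_sublist _)

lemma exists_isRainbowVColoring [Fintype V] [DecidableRel G.Adj] {S : Finset V} (hS : G.WalkConnected S)
    (hU : ∀ x, x ∉ G.undominated S → ((G.undominated S).filter fun v => G.Adj v x).card ≤ 3)
    (hab : ∀ v ∈ G.undominated S, ∃ a b, a ≠ b ∧ G.Adj v a ∧ G.Adj v b ∧
        a ∉ G.undominated S ∧ b ∉ G.undominated S) :
    ∃ c : V → ℕ, IsRainbowVColoring G c (S.card + 4) := by
  classical
  rcases S.eq_empty_or_nonempty with rfl | hSn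
  · refine ⟨fun _ => 0, fun u => ?_⟩
    obtain ⟨a, -, -, -, -, ha, -⟩ := hab u (by simp [mem_undominated])
    simp [mem_undominated] at ha
  have hab' : ∀ v, ∃ a b, v ∈ G.undominated S → a ≠ b ∧ G.Adj v a ∧ G.Adj v b ∧
        a ∉ G.undominated S ∧ b ∉ G.undominated S := by
    intro v
    by_cases hv : v ∈ G.undominated S
    · obtain ⟨a, b, h⟩ := hab v hv
      exact ⟨a, b, fun _ => h⟩
    · exact ⟨v, v, fun h => absurd h hv⟩
  choose a b hab using hab'
  obtain ⟨c₀, hc₀, hsep⟩ := exists_coloring_separating_pairs (G.undominated S) a b 3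
    (fun i hi => (hab i hi).1)
    (by
      intro x
      by_cases hx : x ∈ G.undominated S
      · have hempty : (G.undominated S).filter (fun i => a i = x ∨ b i = x) = ∅ := by
          refine Finset.filter_eq_empty_iff.2 fun {i} hi h => ?_
          rcases h with rfl | rfl
          · exact (hab i hi).2.2.2.1 hx
          · exact (hab i hi).2.2.2.2 hx
        simp [hempty]
      · refine le_trans (Finset.card_le_card ?_) (hU x hx)
        intro i hi
        obtain ⟨hiU, h⟩ := Finset.mem_filter.1 hi
        refine Finset.mem_filter.2 ⟨hiU, ?_⟩
        rcases h with rfl | rfl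
        · exact (hab i hiU).2.1
        · exact (hab i hiU).2.2.1) Finset.univ
  set c : V → ℕ := fun v => if h : v ∈ S then 4 + S.equivFin ⟨v, h⟩ else c₀ v with hc
  have hcS : ∀ v ∈ S, 4 ≤ c v := by
    intro v hv
    simp [hc, hv]
  have hcn : ∀ v, v ∉ S → c v = c₀ v := by
    intro v hv
    simp [hc, hv]
  have hcn4 : ∀ v, v ∉ S → c v < 4 := fun v hv => by rw [hcn v hv]; exact hc₀ v
  have hcinj : ∀ x ∈ S, ∀ y ∈ S, c x = c y → x = y := by
    intro x hx y hy h
    simp only [hc, hx, hy, dif_pos] at h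
    have := S.equivFin.injective (Fin.ext (Nat.add_left_cancel h))
    simpa using this
  have hck : ∀ v, c v < S.card + 4 := by
    intro v
    by_cases hv : v ∈ S
    · have := (S.equivFin ⟨v, hv⟩).2
      simp only [hc, hv, dif_pos]
      lia
    · have := hcn4 v hv
      lia
  refine ⟨c, fun u v => ?_⟩
  have hacc : ∀ x, x ∉ G.undominated S → ∃ s ∈ S, ∃ p : G.Walk x s,
      ∀ w ∈ p.support, w = x ∨ w ∈ S := by
    intro x hx
    by_cases hxS : x ∈ S
    · exact ⟨x, hxS, Walk.nil, by simp⟩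
    · obtain ⟨s, hs, hxs⟩ : ∃ s ∈ S, G.Adj x s := by simpa [mem_undominated, hxS] using hx
      exact ⟨s, hs, Walk.cons hxs Walk.nil, by simp [hs]⟩
  have hjoin : ∀ x y, x ∉ G.undominated S → y ∉ G.undominated S →
      ∃ p : G.Walk x y, ∀ w ∈ p.support, w = x ∨ w = y ∨ w ∈ S := by
    intro x y hx hy
    obtain ⟨s, hs, p, hp⟩ := hacc x hx
    obtain ⟨t, ht, q, hq⟩ := hacc y hy
    obtain ⟨r, hr⟩ := hS s hs t ht
    refine ⟨(p.append r).append q.reverse, fun w hw => ?_⟩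
    simp only [Walk.mem_support_append_iff, Walk.support_reverse, List.mem_reverse] at hw
    rcases hw with (hw | hw) | hw
    · rcases hp w hw with h | h <;> simp [h]
    · simp [hr w hw]
    · rcases hq w hw with h | h <;> simp [h]
  have hstep : ∀ u x : V, x = u ∨ G.Adj u x → ∃ p : G.Walk u x, ∀ w ∈ p.support, w = u ∨ w = x := by
    rintro u x (rfl | h)
    · exact ⟨Walk.nil, by simp⟩
    · exact ⟨Walk.cons h Walk.nil, by simp⟩
  have main : ∀ x y, x ∉ G.undominated S → y ∉ G.undominated S → (x = u ∨ G.Adj u x) →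
      (y = v ∨ G.Adj v y) → (x = u ∨ y = v ∨ c x ≠ c y) →
      ∃ p : G.Walk u v, p.IsPath ∧ (p.support.tail.dropLast.map c).Nodup ∧
        ∀ w ∈ p.support.tail.dropLast, c w < S.card + 4 := by
    intro x y hx hy hux hvy hxy
    obtain ⟨p, hp⟩ := hstep u x hux
    obtain ⟨q, hq⟩ := hstep v y hvy
    obtain ⟨r, hr⟩ := hjoin x y hx hy
    have hsupp : ∀ w ∈ ((p.append r).append q.reverse).support, w ≠ u → w ≠ v →
        w = x ∨ w = y ∨ w ∈ S := by
      intro w hw hwu hwv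
      simp only [Walk.mem_support_append_iff, Walk.support_reverse, List.mem_reverse] at hw
      rcases hw with (hw | hw) | hw
      · rcases hp w hw with h | h
        · exact absurd h hwu
        · exact Or.inl h
      · exact hr w hw
      · rcases hq w hw with h | h
        · exact absurd h hwv
        · exact Or.inr (Or.inl h)
    refine Walk.exists_isPath_rainbow ((p.append r).append q.reverse) c _ hck ?_
    intro w₁ h₁ w₂ h₂ h1u h1v h2u h2v heq
    have hw₁ := hsupp w₁ h₁ h1u h1v
    have hw₂ := hsupp w₂ h₂ h2u h2v
    by_cases h1S : w₁ ∈ S <;> by_cases h2S : w₂ ∈ S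
    · exact hcinj _ h1S _ h2S heq
    · have := hcS _ h1S
      have := hcn4 _ h2S
      lia
    · have := hcS _ h2S
      have := hcn4 _ h1S
      lia
    · simp only [h1S, h2S, or_false] at hw₁ hw₂
      rcases hw₁ with rfl | rfl <;> rcases hw₂ with rfl | rfl
      · rfl
      · rcases hxy with h | h | h
        · exact absurd h h1u
        · exact absurd h h2v
        · exact absurd heq h
      · rcases hxy with h | h | h
        · exact absurd h h2u
        · exact absurd h h1v
        · exact absurd heq.symm h
      · rfl
  by_cases hu : u ∈ G.undominated S
  · obtain ⟨hne, h1, h2, h3, h4⟩ := hab u hu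
    by_cases hv : v ∈ G.undominated S
    · obtain ⟨-, h5, -, h6, -⟩ := hab v hv
      have hnS : ∀ y, G.Adj u y → y ∉ S := fun y hy hyS => (mem_undominated.1 hu).2 y hyS hy
      by_cases hcol : c (a u) = c (a v)
      · refine main (b u) (a v) h4 h6 (Or.inr h2) (Or.inr h5) (Or.inr (Or.inr ?_))
        rw [← hcol, hcn _ (hnS _ h1), hcn _ (hnS _ h2)]
        exact (hsep u hu (Finset.mem_univ _) (Finset.mem_univ _)).symm
      · exact main (a u) (a v) h3 h6 (Or.inr h1) (Or.inr h5) (Or.inr (Or.inr hcol))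
    · exact main (a u) v h3 hv (Or.inr h1) (Or.inl rfl) (Or.inr (Or.inl rfl))
  · by_cases hv : v ∈ G.undominated S
    · obtain ⟨-, h5, -, h6, -⟩ := hab v hv
      exact main u (a v) hu h6 (Or.inl rfl) (Or.inr h5) (Or.inl rfl)
    · exact main u v hu hv (Or.inl rfl) (Or.inl rfl) (Or.inl rfl)

end SimpleGraph

lemma four_le_exp_additive_term {d : ℝ} (h1 : 6 ≤ d) (h2 : d ≤ 15) :
    4 ≤ Real.exp ((3 * Real.log (d ^ 3 + 2 * d ^ 2 + 3) - 3 * (Real.log 3 - 1)) / (d - 3)) := by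
  rw [← Real.log_le_iff_le_exp (by norm_num), le_div_iff₀ (by linarith)]
  have hP : (291 : ℝ) ≤ d ^ 3 + 2 * d ^ 2 + 3 := by nlinarith [mul_self_nonneg (d - 6)]
  have hlog := Real.log_le_log (by norm_num) hP
  have h97 : Real.log 291 - Real.log 3 = Real.log 97 := by
    rw [← Real.log_div (by norm_num) (by norm_num)]
    norm_num
  have h256 : 4 * Real.log 4 ≤ Real.log 97 + 1 := by
    have he : Real.log 97 + 1 = Real.log (97 * Real.exp 1) := by
      rw [Real.log_mul (by norm_num) (Real.exp_pos 1).ne', Real.log_exp]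
    have h4 : 4 * Real.log 4 = Real.log (4 ^ 4) := by
      rw [Real.log_pow]
      norm_num
    rw [he, h4]
    exact Real.log_le_log (by norm_num) (by linarith [Real.exp_one_gt_d9])
  have hpos : 0 ≤ Real.log 4 := Real.log_nonneg (by norm_num)
  nlinarith

theorem stmt_11 {V : Type*} [Fintype V] (G : SimpleGraph V) [DecidableRel G.Adj]
    (hG : G.Connected) (hδ1 : 6 ≤ G.minDegree) (hδ2 : G.minDegree ≤ 15) :
    (rvc G : ℝ) ≤ 4 * (Fintype.card V : ℝ) / (G.minDegree + 1) +
      (Real.exp ((3 * Real.log ((G.minDegree : ℝ) ^ 3 + 2 * (G.minDegree : ℝ) ^ 2 + 3) -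
        3 * (Real.log 3 - 1)) / ((G.minDegree : ℝ) - 3)) - 2) := by
  classical
  obtain ⟨S, hS, hcard, hU, hab⟩ := exists_walkConnected_two_step_dominating hG hδ1 hδ2
  have hrvc : rvc G ≤ S.card + 4 := Nat.sInf_le (exists_isRainbowVColoring hS hU hab)
  have hrvc' : (rvc G : ℝ) ≤ S.card + 4 := by exact_mod_cast hrvc
  have hexp := four_le_exp_additive_term (d := G.minDegree) (by exact_mod_cast hδ1)
    (by exact_mod_cast hδ2)
  have hdiv : (S.card + 2 : ℝ) ≤ 4 * (Fintype.card V : ℝ) / (G.minDegree + 1) := by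
    rw [le_div_iff₀ (by positivity), mul_comm]
    exact_mod_cast hcard
  linarith
end

section
/- A connected graph G of order n with minimum degree δ = 4 satisfies rvc(G) ≤ 3n/5 − 8/5. -/
open SimpleGraph

namespace SimpleGraph

variable {V : Type*} [Fintype V] [DecidableEq V] (G : SimpleGraph V) [DecidableRel G.Adj]

/-- The closed neighbourhood of a set of vertices. -/
def closedNhd (D : Finset V) : Finset V := D ∪ D.biUnion fun d => G.neighborFinset d

/-- The neighbours of `v` outside the closed neighbourhood of `D`. -/
def outNbrs (D : Finset V) (v : V) : Finset V := G.neighborFinset v \ G.closedNhd D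

/-- The vertices outside `D` dominated by `D` all of whose neighbours are dominated by `D`. -/
def deadVerts (D : Finset V) : Finset V :=
  (G.closedNhd D \ D).filter fun v => G.outNbrs D v = ∅

/-- The potential which is not decreased when a connected set is suitably enlarged. -/
def potential (D : Finset V) : ℤ :=
  2 * (G.closedNhd D).card - 4 * D.card + (G.deadVerts D).card

/-- A dominated vertex with an undominated neighbour. -/
def IsLive (D : Finset V) (v : V) : Prop := v ∈ G.closedNhd D ∧ (G.outNbrs D v).Nonempty

/-- A nonempty set any two of whose vertices are joined by a walk within it. -/
def IsConnSet (D : Finset V) : Prop :=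
  D.Nonempty ∧ ∀ u ∈ D, ∀ v ∈ D, ∃ p : G.Walk u v, ∀ w ∈ p.support, w ∈ D

variable {G} {D : Finset V} {b : V}

lemma mem_closedNhd {v : V} : v ∈ G.closedNhd D ↔ v ∈ D ∨ ∃ d ∈ D, G.Adj d v := by
  simp [closedNhd]

lemma mem_outNbrs {v w : V} : w ∈ G.outNbrs D v ↔ G.Adj v w ∧ w ∉ G.closedNhd D := by
  simp [outNbrs]

lemma not_mem_of_outNbrs_nonempty {v : V} (h : (G.outNbrs D v).Nonempty) : v ∉ D := by
  obtain ⟨x, hx⟩ := h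
  rw [mem_outNbrs] at hx
  intro hv
  exact hx.2 (mem_closedNhd.2 (Or.inr ⟨v, hv, hx.1⟩))

lemma IsLive.not_mem (h : G.IsLive D b) : b ∉ D := not_mem_of_outNbrs_nonempty h.2

lemma isLive_of_adj {v x : V} (hv : v ∈ G.closedNhd D) (hx : x ∉ G.closedNhd D)
    (h : G.Adj v x) : G.IsLive D v := ⟨hv, x, mem_outNbrs.2 ⟨h, hx⟩⟩

lemma closedNhd_insert (hb : b ∈ G.closedNhd D) :
    G.closedNhd (insert b D) = G.closedNhd D ∪ G.outNbrs D b := by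
  ext v
  simp only [Finset.mem_union, mem_outNbrs, mem_closedNhd (D := insert b D), Finset.mem_insert]
  constructor
  · rintro ((rfl | h) | ⟨d, rfl | hd, h⟩)
    · exact Or.inl hb
    · exact Or.inl (mem_closedNhd.2 (Or.inl h))
    · tauto
    · exact Or.inl (mem_closedNhd.2 (Or.inr ⟨d, hd, h⟩))
  · rintro (h | h)
    · rcases mem_closedNhd.1 h with h | ⟨d, hd, h⟩
      · exact Or.inl (Or.inr h)
      · exact Or.inr ⟨d, Or.inr hd, h⟩
    · exact Or.inr ⟨b, Or.inl rfl, h.1⟩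

lemma outNbrs_insert (hb : b ∈ G.closedNhd D) (v : V) :
    G.outNbrs (insert b D) v = G.outNbrs D v \ G.outNbrs D b := by
  simp only [outNbrs, closedNhd_insert hb]
  ext w
  simp only [Finset.mem_sdiff, Finset.mem_union]
  tauto

lemma isLive_insert (hb : b ∈ G.closedNhd D) {v : V}
    (hv : v ∈ G.closedNhd D ∨ v ∈ G.outNbrs D b)
    (h : (G.outNbrs D v \ G.outNbrs D b).Nonempty) : G.IsLive (insert b D) v := by
  refine ⟨?_, ?_⟩
  · rw [closedNhd_insert hb]
    exact Finset.mem_union.2 hv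
  · rwa [outNbrs_insert hb]

/-- Adding a live vertex to `D`, where `X` consists of vertices that become dead. -/
lemma potential_insert (hb : G.IsLive D b) (X : Finset V)
    (hX : ∀ w ∈ X, w ≠ b ∧ G.outNbrs D w ⊆ G.outNbrs D b ∧
      (G.IsLive D w ∨ w ∈ G.outNbrs D b)) :
    G.potential D + 2 * (G.outNbrs D b).card - 4 + X.card ≤ G.potential (insert b D) := by
  have h1 : (G.closedNhd (insert b D)).card = (G.closedNhd D).card + (G.outNbrs D b).card := by
    rw [closedNhd_insert hb.1, Finset.card_union_of_disjoint]
    exact Finset.disjoint_sdiff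
  have h2 : (insert b D).card = D.card + 1 := Finset.card_insert_of_notMem hb.not_mem
  have h3 : Disjoint (G.deadVerts D) X := by
    rw [Finset.disjoint_left]
    intro w hw hwX
    simp only [deadVerts, Finset.mem_filter, Finset.mem_sdiff] at hw
    rcases (hX w hwX).2.2 with h | h
    · exact h.2.ne_empty hw.2
    · exact (mem_outNbrs.1 h).2 hw.1.1
  have h4 : G.deadVerts D ∪ X ⊆ G.deadVerts (insert b D) := by
    intro w hw
    simp only [deadVerts, Finset.mem_filter, Finset.mem_sdiff, outNbrs_insert hb.1,
      closedNhd_insert hb.1, Finset.mem_union, Finset.mem_insert] at hw ⊢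
    rcases hw with hw | hw
    · refine ⟨⟨Or.inl hw.1.1, ?_⟩, by simp [hw.2]⟩
      rintro (rfl | h)
      · exact hb.2.ne_empty hw.2
      · exact hw.1.2 h
    · obtain ⟨hwb, hsub, h⟩ := hX w hw
      refine ⟨⟨h.imp And.left id, ?_⟩, Finset.sdiff_eq_empty_iff_subset.2 hsub⟩
      rintro (h' | h')
      · exact hwb h'
      · rcases h with h | h
        · exact h.not_mem h'
        · exact (mem_outNbrs.1 h).2 (mem_closedNhd.2 (Or.inl h'))
  have h5 := Finset.card_le_card h4
  rw [Finset.card_union_of_disjoint h3] at h5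
  simp only [potential, h1, h2]
  push_cast
  zify at h5
  linarith

lemma potential_insert_of_closedNhd_eq_univ (hδ : ∀ v, 4 ≤ (G.neighborFinset v).card)
    (hb : G.IsLive D b) (h : G.closedNhd (insert b D) = Finset.univ) :
    G.potential D + 2 * (G.outNbrs D b).card ≤ G.potential (insert b D) := by
  have hU : ∀ w, w ∉ G.closedNhd D → w ∈ G.outNbrs D b := by
    intro w hw
    have : w ∈ G.closedNhd (insert b D) := by simp [h]
    rw [closedNhd_insert hb.1, Finset.mem_union] at this
    tauto
  obtain ⟨x, hx⟩ := hb.2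
  have hx' := mem_outNbrs.1 hx
  have key := potential_insert hb ((insert x (G.neighborFinset x)).erase b) (by
    intro w hw
    simp only [Finset.mem_erase, Finset.mem_insert, mem_neighborFinset] at hw
    refine ⟨hw.1, fun s hs => hU s (mem_outNbrs.1 hs).2, ?_⟩
    rcases hw.2 with rfl | hxw
    · exact Or.inr hx
    · by_cases hwD : w ∈ G.closedNhd D
      · exact Or.inl (isLive_of_adj hwD hx'.2 hxw.symm)
      · exact Or.inr (hU w hwD))
  have h1 : 4 ≤ ((insert x (G.neighborFinset x)).erase b).card := by
    have h2 := Finset.pred_card_le_card_erase (s := insert x (G.neighborFinset x)) (a := b)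
    have h3 : (insert x (G.neighborFinset x)).card = (G.neighborFinset x).card + 1 :=
      Finset.card_insert_of_notMem (by simp)
    have := hδ x
    omega
  zify at h1
  linarith

omit [Fintype V] [DecidableEq V] [DecidableRel G.Adj] in
lemma IsConnSet.singleton (v : V) : G.IsConnSet {v} := by
  refine ⟨by simp, ?_⟩
  intro u hu w hw
  obtain rfl := Finset.mem_singleton.1 hu
  obtain rfl := Finset.mem_singleton.1 hw
  exact ⟨Walk.nil, by simp⟩

lemma IsConnSet.insert (hD : G.IsConnSet D) (hb : b ∈ G.closedNhd D) :
    G.IsConnSet (insert b D) := by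
  rcases mem_closedNhd.1 hb with h | ⟨d, hd, hdb⟩
  · rwa [Finset.insert_eq_of_mem h]
  refine ⟨by simp, ?_⟩
  have key : ∀ v ∈ D, ∃ p : G.Walk b v, ∀ w ∈ p.support, w ∈ Insert.insert b D := by
    intro v hv
    obtain ⟨p, hp⟩ := hD.2 d hd v hv
    refine ⟨Walk.cons hdb.symm p, ?_⟩
    intro w hw
    rw [Walk.support_cons, List.mem_cons] at hw
    exact Finset.mem_insert.2 (hw.imp id (hp w))
  intro u hu v hv
  rcases Finset.mem_insert.1 hu with rfl | hu' <;> rcases Finset.mem_insert.1 hv with rfl | hv'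
  · exact ⟨Walk.nil, by simp⟩
  · exact key v hv'
  · obtain ⟨p, hp⟩ := key u hu'
    exact ⟨p.reverse, by simpa using hp⟩
  · obtain ⟨p, hp⟩ := hD.2 u hu' v hv'
    exact ⟨p, fun w hw => Finset.mem_insert_of_mem (hp w hw)⟩

lemma exists_isLive (hG : G.Connected) (hD : D.Nonempty) (h : G.closedNhd D ≠ Finset.univ) :
    ∃ v x, v ∈ G.closedNhd D ∧ x ∉ G.closedNhd D ∧ G.Adj v x := by
  obtain ⟨d, hd⟩ := hD
  obtain ⟨y, hy⟩ : ∃ y, y ∉ G.closedNhd D := by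
    by_contra! hc
    exact h (Finset.eq_univ_iff_forall.2 hc)
  obtain ⟨p⟩ := hG d y
  obtain ⟨e, -, h1, h2⟩ := p.exists_boundary_dart (G.closedNhd D : Set V)
    (by simpa using mem_closedNhd.2 (Or.inl hd)) (by simpa using hy)
  exact ⟨e.fst, e.snd, by simpa using h1, by simpa using h2, e.adj⟩

/-- An undominated vertex with few out-neighbours has a live neighbour outside a given small set. -/
lemma exists_isLive_adj (hδ : ∀ v, 4 ≤ (G.neighborFinset v).card) {x : V}
    (hx : x ∉ G.closedNhd D) (S : Finset V) (hS : (G.outNbrs D x).card + S.card < 4) :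
    ∃ w, w ∉ S ∧ G.IsLive D w ∧ x ∈ G.outNbrs D w := by
  obtain ⟨w, hw, hw'⟩ : ∃ w ∈ G.neighborFinset x, w ∉ G.outNbrs D x ∪ S := by
    by_contra! hc
    have h1 := Finset.card_le_card (show G.neighborFinset x ⊆ _ from hc)
    have h2 := Finset.card_union_le (G.outNbrs D x) S
    have := hδ x
    omega
  rw [mem_neighborFinset] at hw
  simp only [Finset.mem_union, mem_outNbrs, not_or, not_and, not_not] at hw'
  exact ⟨w, hw'.2, isLive_of_adj (hw'.1 hw) hx hw.symm, mem_outNbrs.2 ⟨hw.symm, hx⟩⟩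


/-- The local step: a set with deficit one and a vertex with two out-neighbours can be enlarged to
one without deficit. -/
lemma exists_potential_ge_of_two_le (hδ : ∀ v, 4 ≤ (G.neighborFinset v).card) (K : ℤ) (n : ℕ) :
    ∀ D : Finset V, Fintype.card V - D.card = n → G.IsConnSet D → K - 1 ≤ G.potential D →
      ∀ b, G.IsLive D b → 2 ≤ (G.outNbrs D b).card →
      ∃ D', G.IsConnSet D' ∧ D.card < D'.card ∧ K ≤ G.potential D' ∧
        (G.closedNhd D' ≠ Finset.univ ∨ K + 1 ≤ G.potential D') := by
  induction n using Nat.strong_induction_on with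
  | _ n ih =>
  intro D hn hD hg b hb hb2
  by_contra hno
  have hwin : ∀ D', G.IsConnSet D' → D.card < D'.card → K ≤ G.potential D' →
      G.closedNhd D' = Finset.univ ∧ G.potential D' ≤ K := by
    intro D' h1 h2 h3
    by_contra hc
    refine hno ⟨D', h1, h2, h3, ?_⟩
    by_contra! hc'
    exact hc ⟨hc'.1, by omega⟩
  have hcard : ∀ c, G.IsLive D c → (insert c D).card = D.card + 1 := fun c hc =>
    Finset.card_insert_of_notMem hc.not_mem
  have hlt : ∀ c, G.IsLive D c → D.card < (insert c D).card := fun c hc => by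
    rw [hcard c hc]; omega
  -- adding a vertex with at least two out-neighbours gains nothing
  have hle : ∀ c, G.IsLive D c → 2 ≤ (G.outNbrs D c).card →
      G.potential (insert c D) < K := by
    intro c hc hc2
    by_contra! hK
    obtain ⟨h1, h2⟩ := hwin _ (hD.insert hc.1) (hlt c hc) hK
    have := potential_insert_of_closedNhd_eq_univ hδ hc h1
    omega
  have hkey : ∀ c, G.IsLive D c → 2 ≤ (G.outNbrs D c).card → (G.outNbrs D c).card = 2 ∧
      ∀ w, w ≠ c → (G.IsLive D w ∨ w ∈ G.outNbrs D c) →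
        (G.outNbrs D w \ G.outNbrs D c).card = 1 := by
    intro c hc hc2
    have h0 := hle c hc hc2
    have h1 := potential_insert hc ∅ (by simp)
    rw [Finset.card_empty] at h1
    refine ⟨by omega, fun w hwc hw => ?_⟩
    have hpos : (G.outNbrs D w \ G.outNbrs D c).card ≠ 0 := by
      intro h
      rw [Finset.card_eq_zero, Finset.sdiff_eq_empty_iff_subset] at h
      have h2 := potential_insert hc {w} (by
        intro s hs
        rw [Finset.mem_singleton] at hs
        subst hs
        exact ⟨hwc, h, hw⟩)
      rw [Finset.card_singleton] at h2
      omega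
    by_contra hne
    have hw2 : 2 ≤ (G.outNbrs D w \ G.outNbrs D c).card := by omega
    have hlt' : (insert c D).card ≤ Fintype.card V := Finset.card_le_univ _
    have hc1 := hcard c hc
    obtain ⟨D', hD', hcD', hgD'⟩ := ih (Fintype.card V - (insert c D).card) (by omega)
      (insert c D) rfl (hD.insert hc.1) (by omega) w
      (isLive_insert hc.1 (hw.imp And.left id)
        (Finset.card_pos.1 (by omega))) (by rwa [outNbrs_insert hc.1])
    exact hno ⟨D', hD', by omega, hgD'⟩
  have hpair : ∀ c x y, G.IsLive D c → G.outNbrs D c = {x, y} → x ≠ y →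
      ∀ c', c' ≠ c → G.IsLive D c' → x ∈ G.outNbrs D c' →
        ∃ z, z ≠ x ∧ z ≠ y ∧ G.outNbrs D c' = {x, z} := by
    intro c x y hc hxy hne c' hcc hc' hx
    have h1 := (hkey c hc (by rw [hxy, Finset.card_pair hne])).2 c' hcc (Or.inl hc')
    rw [hxy] at h1
    obtain ⟨z, hz⟩ := Finset.card_eq_one.1 h1
    have hz' : z ∈ G.outNbrs D c' \ {x, y} := by simp [hz]
    simp only [Finset.mem_sdiff, Finset.mem_insert, Finset.mem_singleton, not_or] at hz'
    refine ⟨z, hz'.2.1, hz'.2.2, ?_⟩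
    have hsub : {x, z} ⊆ G.outNbrs D c' := by
      intro s hs
      simp only [Finset.mem_insert, Finset.mem_singleton] at hs
      rcases hs with rfl | rfl
      · exact hx
      · exact hz'.1
    have hp : ({x, z} : Finset V).card = 2 := Finset.card_pair (Ne.symm hz'.2.1)
    have h2 : 2 ≤ (G.outNbrs D c').card := hp ▸ Finset.card_le_card hsub
    exact (Finset.eq_of_subset_of_card_le hsub (by rw [(hkey c' hc' h2).1, hp])).symm
  have hnbr : ∀ c x y, G.IsLive D c → G.outNbrs D c = {x, y} → x ≠ y →
      ∃ c' z, c' ≠ c ∧ G.IsLive D c' ∧ z ≠ x ∧ z ≠ y ∧ G.outNbrs D c' = {x, z} := by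
    intro c x y hc hxy hne
    have hx : x ∈ G.outNbrs D c := by simp [hxy]
    have h1 := (hkey c hc (by rw [hxy, Finset.card_pair hne])).2 x
      (mem_outNbrs.1 hx).1.ne' (Or.inr hx)
    have h2 : (G.outNbrs D x).card ≤ 2 := by
      have hs : G.outNbrs D x ⊆ insert y (G.outNbrs D x \ G.outNbrs D c) := by
        intro s hs
        have hsx : s ≠ x := (mem_outNbrs.1 hs).1.ne'
        simp only [hxy, Finset.mem_insert, Finset.mem_sdiff, Finset.mem_singleton]
        tauto
      have := Finset.card_le_card hs
      have := Finset.card_insert_le y (G.outNbrs D x \ G.outNbrs D c)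
      omega
    obtain ⟨c', hcc, hc', hxc⟩ := exists_isLive_adj hδ (mem_outNbrs.1 hx).2 {c} (by simp; omega)
    rw [Finset.mem_singleton] at hcc
    obtain ⟨z, hz⟩ := hpair c x y hc hxy hne c' hcc hc' hxc
    exact ⟨c', z, hcc, hc', hz⟩
  obtain ⟨x, y, hxy, hbxy⟩ := Finset.card_eq_two.1 (hkey b hb hb2).1
  obtain ⟨b₁, z, hb₁b, hb₁, hzx, hzy, hbxz⟩ := hnbr b x y hb hbxy hxy
  obtain ⟨b₂, z', hb₂b, hb₂, hzy', hzx', hbyz⟩ := hnbr b y x hb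
    (by rw [hbxy, Finset.pair_comm]) hxy.symm
  have hb₁₂ : b₂ ≠ b₁ := by
    rintro rfl
    have : y ∈ G.outNbrs D b₂ := by simp [hbyz]
    rw [hbxz] at this
    simp only [Finset.mem_insert, Finset.mem_singleton] at this
    rcases this with h | h
    · exact hxy h.symm
    · exact hzy h.symm
  obtain rfl : z' = z := by
    have h1 := (hkey b₁ hb₁ (by rw [hbxz, Finset.card_pair hzx.symm])).2 b₂ hb₁₂ (Or.inl hb₂)
    by_contra hne
    have : G.outNbrs D b₂ \ G.outNbrs D b₁ = {y, z'} := by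
      rw [hbyz, hbxz, Finset.sdiff_eq_self_iff_disjoint]
      simp [hxy, hzx'.symm, hzy, Ne.symm hne]
    rw [this, Finset.card_pair hzy'.symm] at h1
    omega
  have htri : ∀ c c₁ c₂ x y z, G.IsLive D c → G.IsLive D c₁ → G.IsLive D c₂ → x ≠ y → z ≠ x →
      z ≠ y → G.outNbrs D c = {x, y} → G.outNbrs D c₁ = {x, z} → G.outNbrs D c₂ = {y, z} →
      G.outNbrs D x ⊆ {y, z} := by
    intro c c₁ c₂ x y z hc hc₁ hc₂ hxy hzx hzy e e₁ e₂ s hs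
    by_contra hsn
    simp only [Finset.mem_insert, Finset.mem_singleton, not_or] at hsn
    have hx : x ∈ G.outNbrs D c := by simp [e]
    have hx₁ : x ∈ G.outNbrs D c₁ := by simp [e₁]
    have hxx : ∀ s, s ∈ G.outNbrs D x → s ≠ x := fun s hs => (mem_outNbrs.1 hs).1.ne'
    have k := hkey c hc (by rw [e, Finset.card_pair hxy])
    have k₁ := hkey c₁ hc₁ (by rw [e₁, Finset.card_pair hzx.symm])
    have k₂ := hkey c₂ hc₂ (by rw [e₂, Finset.card_pair hzy.symm])
    have h1 := k.2 x (mem_outNbrs.1 hx).1.ne' (Or.inr hx)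
    have h2 := k₁.2 x (mem_outNbrs.1 hx₁).1.ne' (Or.inr hx₁)
    rw [e] at h1
    rw [e₁] at h2
    have hsub : G.outNbrs D x ⊆ {s} := by
      intro r hr
      have hsx := hxx s hs
      have hrx := hxx r hr
      rw [Finset.mem_singleton]
      by_cases hry : r = y
      · refine Finset.card_le_one.1 h2.le r ?_ s ?_ <;>
          simp only [Finset.mem_sdiff, Finset.mem_insert, Finset.mem_singleton, not_or]
        · exact ⟨hr, hrx, fun h => hzy (h.symm.trans hry)⟩
        · exact ⟨hs, hsx, hsn.2⟩
      · refine Finset.card_le_one.1 h1.le r ?_ s ?_ <;>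
          simp only [Finset.mem_sdiff, Finset.mem_insert, Finset.mem_singleton, not_or]
        · exact ⟨hr, hrx, hry⟩
        · exact ⟨hs, hsx, hsn.1⟩
    have hcard1 := Finset.card_le_card hsub
    have hcard2 := Finset.card_le_two (a := c) (b := c₁)
    rw [Finset.card_singleton] at hcard1
    obtain ⟨c₃, hc₃n, hc₃, hxc₃⟩ := exists_isLive_adj hδ (mem_outNbrs.1 hx).2 {c, c₁} (by omega)
    simp only [Finset.mem_insert, Finset.mem_singleton, not_or] at hc₃n
    obtain ⟨q, hqx, hqy, e₃⟩ := hpair c x y hc e hxy c₃ hc₃n.1 hc₃ hxc₃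
    have h3 := k₁.2 c₃ hc₃n.2 (Or.inl hc₃)
    rw [e₃, e₁] at h3
    have hqz : q ≠ z := by
      rintro rfl
      simp at h3
    have h4 := k₂.2 c₃ (by
      rintro rfl
      rw [e₂] at hxc₃
      simp only [Finset.mem_insert, Finset.mem_singleton] at hxc₃
      exact hxc₃.elim hxy hzx.symm) (Or.inl hc₃)
    have : G.outNbrs D c₃ \ G.outNbrs D c₂ = {x, q} := by
      rw [e₃, e₂, Finset.sdiff_eq_self_iff_disjoint]
      simp [hxy.symm, hqy.symm, hqz.symm, hzx]
    rw [this, Finset.card_pair hqx.symm] at h4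
    omega
  have tx := htri b b₁ b₂ x y z' hb hb₁ hb₂ hxy hzx hzy hbxy hbxz hbyz
  have ty := htri b b₂ b₁ y x z' hb hb₂ hb₁ hxy.symm hzy hzx
    (by rw [hbxy, Finset.pair_comm]) hbyz hbxz
  have tz := htri b₁ b₂ b z' x y hb₁ hb₂ hb hzx hzy.symm hxy.symm
    (by rw [hbxz, Finset.pair_comm]) (by rw [hbyz, Finset.pair_comm]) hbxy
  have hxb : x ∈ G.outNbrs D b := by simp [hbxy]
  have hyb : y ∈ G.outNbrs D b := by simp [hbxy]
  have hxb₁ : x ∈ G.outNbrs D b₁ := by simp [hbxz]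
  have hzb₁ : z' ∈ G.outNbrs D b₁ := by simp [hbxz]
  have k := hkey b hb hb2
  have g1 := potential_insert hb ∅ (by simp)
  have hE : G.outNbrs (insert b D) b₁ = {z'} := by
    rw [outNbrs_insert hb.1, hbxz, hbxy]
    ext s
    simp only [Finset.mem_sdiff, Finset.mem_insert, Finset.mem_singleton, not_or]
    constructor
    · tauto
    · rintro rfl
      tauto
  have hlive : ∀ w, w ≠ b → (G.IsLive D w ∨ w ∈ G.outNbrs D b) → G.IsLive (insert b D) w := by
    intro w hwb hw
    exact isLive_insert hb.1 (hw.imp And.left id) (Finset.card_pos.1 (by rw [k.2 w hwb hw]; simp))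
  have hb₁' : G.IsLive (insert b D) b₁ := hlive b₁ hb₁b (Or.inl hb₁)
  have hxD := (mem_outNbrs.1 hxb).2
  have hyD := (mem_outNbrs.1 hyb).2
  have hzD := (mem_outNbrs.1 hzb₁).2
  have g2 := potential_insert hb₁' {x, y, z', b₂} (by
    intro w hw
    simp only [Finset.mem_insert, Finset.mem_singleton] at hw
    rw [hE]
    rcases hw with rfl | rfl | rfl | rfl
    · refine ⟨fun h => hxD (h ▸ hb₁.1), ?_, Or.inl (hlive w (fun h => hxD (h ▸ hb.1)) (Or.inr hxb))⟩
      rw [outNbrs_insert hb.1, hbxy]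
      intro s hs
      have := @tx s
      simp only [Finset.mem_sdiff, Finset.mem_insert, Finset.mem_singleton] at this hs ⊢
      tauto
    · refine ⟨fun h => hyD (h ▸ hb₁.1), ?_, Or.inl (hlive w (fun h => hyD (h ▸ hb.1)) (Or.inr hyb))⟩
      rw [outNbrs_insert hb.1, hbxy]
      intro s hs
      have := @ty s
      simp only [Finset.mem_sdiff, Finset.mem_insert, Finset.mem_singleton] at this hs ⊢
      tauto
    · refine ⟨fun h => hzD (h ▸ hb₁.1), ?_, Or.inr (by simp)⟩
      rw [outNbrs_insert hb.1, hbxy]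
      intro s hs
      have := @tz s
      simp only [Finset.mem_sdiff, Finset.mem_insert, Finset.mem_singleton] at this hs ⊢
      tauto
    · refine ⟨hb₁₂, ?_, Or.inl (hlive w hb₂b (Or.inl hb₂))⟩
      rw [outNbrs_insert hb.1, hbxy, hbyz]
      intro s hs
      simp only [Finset.mem_sdiff, Finset.mem_insert, Finset.mem_singleton] at hs ⊢
      tauto)
  have hX : ({x, y, z', b₂} : Finset V).card = 4 := by
    have h1 : x ≠ b₂ := fun h => hxD (h ▸ hb₂.1)
    have h2 : y ≠ b₂ := fun h => hyD (h ▸ hb₂.1)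
    have h3 : z' ≠ b₂ := fun h => hzD (h ▸ hb₂.1)
    rw [Finset.card_insert_of_notMem, Finset.card_insert_of_notMem, Finset.card_pair h3]
    · simp [hzy.symm, h2]
    · simp [hxy, hzx.symm, h1]
  rw [hX, hE, Finset.card_singleton] at g2
  rw [k.1, Finset.card_empty] at g1
  push_cast at g1 g2
  have hcb := hcard b hb
  have hcb₁ := Finset.card_insert_of_notMem hb₁'.not_mem
  have := (hwin (insert b₁ (insert b D)) ((hD.insert hb.1).insert hb₁'.1)
    (by omega) (by omega)).2
  omega

/-- A connected set which is not dominating can be enlarged without decreasing its potential. -/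
lemma exists_potential_ge (hG : G.Connected) (hδ : ∀ v, 4 ≤ (G.neighborFinset v).card)
    (hD : G.IsConnSet D) (h : G.closedNhd D ≠ Finset.univ) :
    ∃ D', G.IsConnSet D' ∧ D.card < D'.card ∧ G.potential D ≤ G.potential D' ∧
        (G.closedNhd D' ≠ Finset.univ ∨ G.potential D + 1 ≤ G.potential D') := by
  by_contra hno
  have hone : ∀ c, G.IsLive D c → G.potential (insert c D) < G.potential D := by
    intro c hc
    by_contra! hK
    refine hno ⟨insert c D, hD.insert hc.1, ?_, hK, ?_⟩
    · rw [Finset.card_insert_of_notMem hc.not_mem]; omega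
    · by_contra! hc'
      have h1 := potential_insert_of_closedNhd_eq_univ hδ hc hc'.1
      have h2 := Finset.card_pos.2 hc.2
      omega
  obtain ⟨v, x, hv, hx, hvx⟩ := exists_isLive hG hD.1 h
  have hvl : G.IsLive D v := isLive_of_adj hv hx hvx
  have hcard1 : ∀ c, G.IsLive D c → (G.outNbrs D c).card = 1 := by
    intro c hc
    have h1 := hone c hc
    have h2 := potential_insert hc ∅ (by simp)
    have h3 := Finset.card_pos.2 hc.2
    rw [Finset.card_empty] at h2
    omega
  have hxv : x ∈ G.outNbrs D v := mem_outNbrs.2 ⟨hvx, hx⟩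
  have hsing : ∀ c, G.IsLive D c → x ∈ G.outNbrs D c → G.outNbrs D c = {x} := by
    intro c hc hxc
    obtain ⟨a, ha⟩ := Finset.card_eq_one.1 (hcard1 c hc)
    rw [ha, Finset.mem_singleton] at hxc
    rw [ha, hxc]
  have hvE := hsing v hvl hxv
  have hnb : ∀ w, w ≠ v → w ∈ G.closedNhd D → G.Adj w x →
      w ≠ v ∧ G.outNbrs D w ⊆ G.outNbrs D v ∧ (G.IsLive D w ∨ w ∈ G.outNbrs D v) := by
    intro w hwv hw hwx
    have hwl := isLive_of_adj hw hx hwx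
    exact ⟨hwv, by rw [hsing w hwl (mem_outNbrs.2 ⟨hwx, hx⟩), hvE], Or.inl hwl⟩
  have hone' := hone v hvl
  have ht : 2 ≤ (G.outNbrs D x).card := by
    by_contra! hu
    have h1 := potential_insert hvl ((G.neighborFinset x \ G.outNbrs D x).erase v) (by
      intro w hw
      simp only [Finset.mem_erase, Finset.mem_sdiff, mem_outNbrs, mem_neighborFinset, not_and,
        not_not] at hw
      exact hnb w hw.1 (hw.2.2 hw.2.1) hw.2.1.symm)
    have h2 := Finset.pred_card_le_card_erase
      (s := G.neighborFinset x \ G.outNbrs D x) (a := v)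
    have h3 := Finset.le_card_sdiff (G.outNbrs D x) (G.neighborFinset x)
    have h4 := hδ x
    have h5 := hcard1 v hvl
    omega
  have hxE : G.outNbrs (insert v D) x = G.outNbrs D x := by
    rw [outNbrs_insert hv, hvE, Finset.sdiff_eq_self_iff_disjoint]
    simp [mem_outNbrs]
  have hxl : G.IsLive (insert v D) x := by
    refine isLive_insert hv (Or.inr hxv) ?_
    rw [← outNbrs_insert hv, hxE]
    exact Finset.card_pos.1 (by omega)
  have hc1 : (insert v D).card = D.card + 1 := Finset.card_insert_of_notMem hvl.not_mem
  have hconn := hD.insert hv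
  by_cases hu : 3 ≤ (G.outNbrs D x).card
  · have g1 := potential_insert hvl ∅ (by simp)
    have g2 := potential_insert hxl ∅ (by simp)
    have hc2 := Finset.card_insert_of_notMem hxl.not_mem
    have h5 := hcard1 v hvl
    rw [hxE] at g2
    rw [Finset.card_empty] at g1 g2
    refine hno ⟨insert x (insert v D), hconn.insert hxl.1, by omega, by omega, ?_⟩
    by_contra! hc'
    have h6 := potential_insert_of_closedNhd_eq_univ hδ hxl hc'.1
    rw [hxE] at h6
    omega
  · obtain ⟨w, hwv, hw, hxw⟩ := exists_isLive_adj hδ hx {v} (by simp; omega)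
    rw [Finset.mem_singleton] at hwv
    have g1 := potential_insert hvl {w} (by
      intro s hs
      rw [Finset.mem_singleton] at hs
      subst hs
      exact hnb s hwv hw.1 (mem_outNbrs.1 hxw).1)
    rw [Finset.card_singleton, hcard1 v hvl] at g1
    obtain ⟨D', h1, h2, h3⟩ := exists_potential_ge_of_two_le hδ (G.potential D) _ (insert v D) rfl
      hconn (by push_cast at g1; omega) x hxl (by rw [hxE]; omega)
    exact hno ⟨D', h1, by omega, h3⟩

lemma exists_dominating_of_potential (hG : G.Connected)
    (hδ : ∀ v, 4 ≤ (G.neighborFinset v).card) (n : ℕ) :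
    ∀ D : Finset V, Fintype.card V - D.card = n → G.IsConnSet D → 7 ≤ G.potential D →
      (G.closedNhd D ≠ Finset.univ ∨ 8 ≤ G.potential D) →
      ∃ D', G.IsConnSet D' ∧ G.closedNhd D' = Finset.univ ∧ 8 ≤ G.potential D' := by
  induction n using Nat.strong_induction_on with
  | _ n ih =>
  intro D hn hD h7 h8
  by_cases hU : G.closedNhd D = Finset.univ
  · exact ⟨D, hD, hU, h8.resolve_left (not_not_intro hU)⟩
  obtain ⟨D', h1, h2, h3, h4⟩ := exists_potential_ge hG hδ hD hU
  have := Finset.card_le_univ D'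
  exact ih (Fintype.card V - D'.card) (by omega) D' rfl h1 (by omega) (h4.imp id (by omega))

/-- The case in which every edge is in many triangles. -/
lemma exists_dominating_of_card_le_one (hG : G.Connected)
    (hδ : ∀ v, 4 ≤ (G.neighborFinset v).card)
    (htri : ∀ v w, G.Adj v w → (G.outNbrs {v} w).card ≤ 1) (n : ℕ) :
    ∀ D : Finset V, Fintype.card V - D.card = n → G.IsConnSet D → 6 ≤ G.potential D →
      (G.closedNhd D ≠ Finset.univ ∨ 8 ≤ G.potential D) →
      ∃ D', G.IsConnSet D' ∧ G.closedNhd D' = Finset.univ ∧ 8 ≤ G.potential D' := by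
  induction n using Nat.strong_induction_on with
  | _ n ih =>
  intro D hn hD h6 h8
  by_cases hU : G.closedNhd D = Finset.univ
  · exact ⟨D, hD, hU, h8.resolve_left (not_not_intro hU)⟩
  obtain ⟨b, x, hb, hx, hbx⟩ := exists_isLive hG hD.1 hU
  have hbl : G.IsLive D b := isLive_of_adj hb hx hbx
  have hadj : ∀ d ∈ D, ∀ w, G.Adj d w → ∀ s, G.Adj w s → s ∉ G.closedNhd D →
      ∀ r, G.Adj w r → r ≠ s → r = d ∨ G.Adj d r := by
    intro d hd w hdw s hws hs r hwr hrs
    by_contra! hc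
    refine hrs (Finset.card_le_one.1 (htri d w hdw) r ?_ s ?_) <;>
      simp only [mem_outNbrs, mem_closedNhd, Finset.mem_singleton, exists_eq_left, not_or]
    · exact ⟨hwr, hc⟩
    · simp only [mem_closedNhd, not_or, not_exists, not_and] at hs
      exact ⟨hws, fun h => hs.1 (h ▸ hd), hs.2 d hd⟩
  obtain ⟨d, hd, hdb⟩ := (mem_closedNhd.1 hb).resolve_left hbl.not_mem
  have hdx : ¬ G.Adj d x := fun h => hx (mem_closedNhd.2 (Or.inr ⟨d, hd, h⟩))
  have hdx' : d ≠ x := fun h => hx (mem_closedNhd.2 (Or.inl (h ▸ hd)))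
  have hxb : x ∈ G.outNbrs D b := mem_outNbrs.2 ⟨hbx, hx⟩
  have key := potential_insert hbl (((G.neighborFinset b).erase d).erase x) (by
    intro w hw
    simp only [Finset.mem_erase, mem_neighborFinset] at hw
    obtain ⟨hwx, hwd, hbw⟩ := hw
    have hdw : G.Adj d w := (hadj d hd b hdb x hbx hx w hbw hwx).resolve_left hwd
    have hxw : G.Adj x w := by
      by_contra hc
      refine hwd (Finset.card_le_one.1 (htri x b hbx.symm) w ?_ d ?_) <;>
        simp only [mem_outNbrs, mem_closedNhd, Finset.mem_singleton, exists_eq_left, not_or]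
      · exact ⟨hbw, hwx, hc⟩
      · exact ⟨hdb.symm, hdx', fun h => hdx h.symm⟩
    refine ⟨hbw.ne', ?_, Or.inl (isLive_of_adj (mem_closedNhd.2 (Or.inr ⟨d, hd, hdw⟩)) hx
      hxw.symm)⟩
    intro s hs
    rw [mem_outNbrs] at hs
    by_contra hsb
    have hsx : x ≠ s := by
      rintro rfl
      exact hsb hxb
    rcases hadj d hd w hdw s hs.1 hs.2 x hxw.symm hsx with h | h
    · exact hdx' h.symm
    · exact hdx h)
  have h1 := Finset.pred_card_le_card_erase (s := (G.neighborFinset b).erase d) (a := x)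
  have h2 := Finset.pred_card_le_card_erase (s := G.neighborFinset b) (a := d)
  have h3 := hδ b
  have h4 := Finset.card_pos.2 hbl.2
  have hc := Finset.card_insert_of_notMem hbl.not_mem
  have h5 := Finset.card_le_univ (insert b D)
  refine ih (Fintype.card V - (insert b D).card) (by omega) _ rfl (hD.insert hb) (by omega) ?_
  by_contra! hc'
  have := potential_insert_of_closedNhd_eq_univ hδ hbl hc'.1
  omega

/-- The Kleitman–West bound: a connected graph with minimum degree at least four has a connected
dominating set of size at most `(3n - 8) / 5`. -/
lemma exists_connected_dominating (hG : G.Connected)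
    (hδ : ∀ v, 4 ≤ (G.neighborFinset v).card) :
    ∃ D, G.IsConnSet D ∧ G.closedNhd D = Finset.univ ∧ 5 * D.card + 8 ≤ 3 * Fintype.card V := by
  have hpot : ∀ v, 2 * ((G.neighborFinset v).card : ℤ) - 2 + (G.deadVerts {v}).card
      = G.potential {v} := by
    intro v
    have : G.closedNhd {v} = insert v (G.neighborFinset v) := by
      simp [closedNhd]
    rw [potential, this, Finset.card_insert_of_notMem (by simp)]
    simp
    ring
  have h6 : ∀ v, 6 ≤ G.potential {v} := by
    intro v
    have := hpot v
    have := hδ v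
    omega
  obtain ⟨D, h1, h2, h3⟩ : ∃ D, G.IsConnSet D ∧ G.closedNhd D = Finset.univ ∧
      8 ≤ G.potential D := by
    by_cases htri : ∀ v w, G.Adj v w → (G.outNbrs {v} w).card ≤ 1
    · obtain ⟨v⟩ := hG.nonempty
      refine exists_dominating_of_card_le_one hG hδ htri _ {v} rfl (.singleton v) (h6 v) ?_
      by_contra! hc
      have hdead : G.deadVerts {v} = G.closedNhd {v} \ {v} := by
        refine Finset.filter_true_of_mem fun w _ => ?_
        simp [outNbrs, hc.1]
      have hcl : G.closedNhd {v} \ {v} = G.neighborFinset v := by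
        ext w
        simp only [closedNhd, Finset.singleton_biUnion, Finset.mem_sdiff, Finset.mem_union,
          Finset.mem_singleton, mem_neighborFinset]
        exact ⟨fun h => h.1.resolve_left h.2, fun h => ⟨Or.inr h, h.ne'⟩⟩
      have := hpot v
      rw [hdead, hcl] at this
      have := hδ v
      omega
    · push Not at htri
      obtain ⟨v, w, hvw, h⟩ := htri
      have hw : G.IsLive {v} w := ⟨mem_closedNhd.2 (Or.inr ⟨v, by simp, hvw⟩),
        Finset.card_pos.1 (by omega)⟩
      obtain ⟨D, h1, -, h2, h3⟩ := exists_potential_ge_of_two_le hδ 7 _ {v} rfl (.singleton v)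
        (by have := h6 v; omega) w hw h
      exact exists_dominating_of_potential hG hδ _ D rfl h1 h2 (h3.imp id (by omega))
  refine ⟨D, h1, h2, ?_⟩
  have hdead : G.deadVerts D = Finset.univ \ D := by
    rw [deadVerts, h2]
    refine Finset.filter_true_of_mem fun w _ => ?_
    simp [outNbrs, h2]
  rw [potential, hdead, h2, Finset.card_univ_sdiff, Finset.card_univ] at h3
  have := Finset.card_le_univ D
  omega

/-- A connected dominating set can be given distinct colors. -/
lemma rvc_le_card (hD : G.IsConnSet D) (h : G.closedNhd D = Finset.univ) :
    rvc G ≤ D.card := by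
  have hwalk : ∀ u v, ∃ p : G.Walk u v, ∀ w ∈ p.support, w = u ∨ w = v ∨ w ∈ D := by
    have hnear : ∀ u, ∃ d ∈ D, ∃ p : G.Walk u d, ∀ w ∈ p.support, w = u ∨ w ∈ D := by
      intro u
      rcases mem_closedNhd.1 (h ▸ Finset.mem_univ u) with hu | ⟨d, hd, hdu⟩
      · exact ⟨u, hu, Walk.nil, by simp⟩
      · refine ⟨d, hd, Walk.cons hdu.symm Walk.nil, ?_⟩
        simp only [Walk.support_cons, Walk.support_nil, List.mem_cons, List.not_mem_nil, or_false]
        rintro w (rfl | rfl)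
        · exact Or.inl rfl
        · exact Or.inr hd
    intro u v
    obtain ⟨d, hd, p, hp⟩ := hnear u
    obtain ⟨e, he, q, hq⟩ := hnear v
    obtain ⟨r, hr⟩ := hD.2 d hd e he
    refine ⟨(p.append r).append q.reverse, fun w hw => ?_⟩
    simp only [Walk.mem_support_append_iff, Walk.support_reverse, List.mem_reverse] at hw
    rcases hw with (hw | hw) | hw
    · have := hp w hw; tauto
    · have := hr w hw; tauto
    · have := hq w hw; tauto
  refine Nat.sInf_le ⟨fun v => if hv : v ∈ D then D.equivFin ⟨v, hv⟩ else 0, fun u v => ?_⟩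
  obtain ⟨p, hp⟩ := hwalk u v
  have hmem : ∀ w ∈ p.bypass.support.tail.dropLast, w ∈ D := by
    intro w hw
    have hnd := p.bypass_isPath.support_nodup
    have hwu : w ≠ u := by
      rintro rfl
      rw [← Walk.cons_tail_support] at hnd
      exact (List.nodup_cons.1 hnd).1 (List.mem_of_mem_dropLast hw)
    have hwv : w ≠ v := by
      rintro rfl
      have hne := List.ne_nil_of_mem (List.mem_of_mem_dropLast hw)
      have hnd' := hnd.tail
      rw [← List.dropLast_append_getLast hne, List.getLast_tail, Walk.getLast_support] at hnd'
      exact (List.nodup_append.1 hnd').2.2 w hw w (by simp) rfl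
    have hws : w ∈ p.support := p.support_bypass_subset_support
      (List.mem_of_mem_tail (List.mem_of_mem_dropLast hw))
    have := hp w hws
    tauto
  refine ⟨p.bypass, p.bypass_isPath, ?_, ?_⟩
  · refine List.Nodup.map_on ?_ ((p.bypass_isPath.support_nodup.tail).sublist
      (List.dropLast_sublist _))
    intro a ha c hc hac
    simpa [hmem a ha, hmem c hc, Fin.val_inj] using hac
  · intro w hw
    simp [hmem w hw]

end SimpleGraph

theorem stmt_13 {V : Type*} [Fintype V] (G : SimpleGraph V) [DecidableRel G.Adj]
    (hG : G.Connected) (hδ : G.minDegree = 4) :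
    (rvc G : ℝ) ≤ 3 * (Fintype.card V : ℝ) / 5 - 8 / 5 := by
  classical
  obtain ⟨D, h1, h2, h3⟩ := exists_connected_dominating hG fun v => by
    rw [card_neighborFinset_eq_degree, ← hδ]
    exact G.minDegree_le_degree v
  have h4 : (5 * rvc G + 8 : ℝ) ≤ 3 * Fintype.card V := by
    have := rvc_le_card h1 h2
    exact_mod_cast (by omega : 5 * rvc G + 8 ≤ 3 * Fintype.card V)
  linarith
end

section
/- A connected graph G of order n with minimum degree δ = 5 satisfies rvc(G) ≤ n/2 − 2. -/
open SimpleGraph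

namespace RainbowDomination

section

open scoped Classical

variable {V : Type*} {G : SimpleGraph V}

/-- Some walk from `u` to `v` stays in `W` apart from its ends. -/
def Linked (G : SimpleGraph V) (W : Finset V) (u v : V) : Prop :=
  ∃ p : G.Walk u v, ∀ w ∈ p.support, w = u ∨ w = v ∨ w ∈ W

/-- Any two vertices of `D` are joined by a walk inside `D`. -/
def ConnSet (G : SimpleGraph V) (D : Finset V) : Prop :=
  ∀ x ∈ D, ∀ y ∈ D, Linked G D x y

lemma Linked.mono {W W' : Finset V} {u v : V} (h : Linked G W u v) (hW : W ⊆ W') :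
    Linked G W' u v := by
  obtain ⟨p, hp⟩ := h
  exact ⟨p, fun w hw => (hp w hw).imp_right fun h => h.imp_right fun h => hW h⟩

lemma Linked.symm {W : Finset V} {u v : V} (h : Linked G W u v) : Linked G W v u := by
  obtain ⟨p, hp⟩ := h
  refine ⟨p.reverse, fun w hw => ?_⟩
  have := hp w (by simpa using hw)
  tauto

lemma Linked.refl (W : Finset V) (u : V) : Linked G W u u :=
  ⟨Walk.nil, by simp⟩

lemma Linked.of_adj (W : Finset V) {u v : V} (h : G.Adj u v) : Linked G W u v :=
  ⟨Walk.cons h Walk.nil, by simp⟩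

lemma Linked.cons {W : Finset V} {u a v : V} (h : G.Adj u a) (hl : Linked G W a v) :
    Linked G (insert a W) u v := by
  obtain ⟨p, hp⟩ := hl
  refine ⟨Walk.cons h p, fun w hw => ?_⟩
  rw [Walk.support_cons, List.mem_cons] at hw
  rcases hw with rfl | hw
  · exact Or.inl rfl
  · have := hp w hw
    simp only [Finset.mem_insert]
    tauto

lemma Linked.exists_isPath {W : Finset V} {u v : V} (h : Linked G W u v) {c : V → ℕ} {k : ℕ}
    (hinj : Set.InjOn c W) (hk : ∀ w, c w < k) :
    ∃ p : G.Walk u v, p.IsPath ∧ (p.support.tail.dropLast.map c).Nodup ∧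
      ∀ w ∈ p.support.tail.dropLast, c w < k := by
  obtain ⟨p, hp⟩ := h
  refine ⟨p.bypass, p.bypass_isPath, ?_, fun w _ => hk w⟩
  have hsub : ∀ w ∈ p.bypass.support, w = u ∨ w = v ∨ w ∈ W :=
    fun w hw => hp w (p.support_bypass_subset_support hw)
  have hnd := p.bypass_isPath.support_nodup
  have key : ∀ w ∈ p.bypass.support.tail.dropLast, w ∈ W := by
    intro w hw
    have hwt := List.mem_of_mem_dropLast hw
    rcases hsub w (List.mem_of_mem_tail hwt) with rfl | rfl | h
    · rw [← Walk.cons_tail_support] at hnd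
      exact absurd hwt (List.nodup_cons.1 hnd).1
    · exfalso
      revert hw hnd
      generalize p.bypass = q
      cases q with
      | nil => simp
      | cons h q =>
        intro hnd hw
        rw [Walk.support_cons, List.tail_cons] at hw
        rw [Walk.support_cons, List.nodup_cons] at hnd
        have h2 := hnd.2
        rw [← List.dropLast_append_getLast q.support_ne_nil, List.nodup_append] at h2
        exact h2.2.2 _ hw _ (by simp) rfl
    · exact h
  refine List.Nodup.map_on ?_ ?_
  · exact fun x hx y hy hxy => hinj (key x hx) (key y hy) hxy
  · exact (hnd.sublist (List.tail_sublist _)).sublist (List.dropLast_sublist _)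

lemma connSet_singleton (x : V) : ConnSet G {x} := by
  intro a ha b hb
  rw [Finset.mem_singleton] at ha hb
  subst ha hb
  exact Linked.refl _ _

lemma exists_numbering (D : Finset V) :
    ∃ f : V → ℕ, Set.InjOn f D ∧ ∀ v ∈ D, f v < D.card := by
  refine ⟨fun v => if h : v ∈ D then (D.equivFin ⟨v, h⟩ : ℕ) else 0, ?_, ?_⟩
  · intro x hx y hy hxy
    rw [Finset.mem_coe] at hx hy
    simp only [hx, hy, dif_pos] at hxy
    simpa using D.equivFin.injective (Fin.ext hxy)
  · intro v hv
    simp [hv]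

lemma injOn_insert {c : V → ℕ} {W : Finset V} {a : V} (hW : Set.InjOn c W)
    (ha : ∀ w ∈ W, c w ≠ c a) : Set.InjOn c (insert a W : Finset V) := by
  intro x hx y hy hxy
  simp only [Finset.coe_insert, Set.mem_insert_iff, Finset.mem_coe] at hx hy
  rcases hx with rfl | hx <;> rcases hy with rfl | hy
  · rfl
  · exact absurd hxy.symm (ha y hy)
  · exact absurd hxy (ha x hx)
  · exact hW hx hy hxy

lemma rvc_le_of_linked {c : V → ℕ} {k : ℕ} (hc : ∀ v, c v < k)
    (h : ∀ u v, ∃ W : Finset V, Set.InjOn c W ∧ Linked G W u v) : rvc G ≤ k := by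
  refine Nat.sInf_le ⟨c, fun u v => ?_⟩
  obtain ⟨W, hW, hl⟩ := h u v
  exact hl.exists_isPath hW hc

lemma rvc_le_one (h : ∀ u v, u = v ∨ G.Adj u v ∨ ∃ w, G.Adj u w ∧ G.Adj w v) : rvc G ≤ 1 := by
  refine rvc_le_of_linked (c := fun _ => 0) (fun _ => one_pos) fun u v => ?_
  rcases h u v with rfl | h | ⟨w, huw, hwv⟩
  · exact ⟨∅, by simp, Linked.refl _ _⟩
  · exact ⟨∅, by simp, Linked.of_adj _ h⟩
  · exact ⟨{w}, by simp, Linked.cons huw (Linked.of_adj ∅ hwv)⟩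

variable [Fintype V]

/-- The closed neighborhood of a vertex set. -/
noncomputable def closedNhd (G : SimpleGraph V) (D : Finset V) : Finset V :=
  Finset.univ.filter fun v => v ∈ D ∨ ∃ d ∈ D, G.Adj d v

/-- The vertices that have a neighbor in `L`, that neighbor being their only dominator in `D`. -/
noncomputable def privNhd (G : SimpleGraph V) (D L : Finset V) : Finset V :=
  Finset.univ.filter fun v => ∃ l ∈ L, G.Adj l v ∧ v ∉ closedNhd G (D.erase l)

lemma mem_closedNhd {D : Finset V} {v : V} :
    v ∈ closedNhd G D ↔ v ∈ D ∨ ∃ d ∈ D, G.Adj d v := by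
  simp [closedNhd]

lemma mem_privNhd {D L : Finset V} {v : V} :
    v ∈ privNhd G D L ↔ ∃ l ∈ L, G.Adj l v ∧ v ∉ closedNhd G (D.erase l) := by
  simp [privNhd]

lemma subset_closedNhd (D : Finset V) : D ⊆ closedNhd G D :=
  fun _ h => mem_closedNhd.2 (Or.inl h)

lemma closedNhd_mono {D E : Finset V} (h : D ⊆ E) : closedNhd G D ⊆ closedNhd G E := by
  intro v hv
  rw [mem_closedNhd] at hv ⊢
  rcases hv with hv | ⟨d, hd, hdv⟩
  · exact Or.inl (h hv)
  · exact Or.inr ⟨d, h hd, hdv⟩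

lemma mem_closedNhd_of_adj {D : Finset V} {d v : V} (hd : d ∈ D) (h : G.Adj d v) :
    v ∈ closedNhd G D :=
  mem_closedNhd.2 (Or.inr ⟨d, hd, h⟩)

lemma ConnSet.linked {E : Finset V} (hE : ConnSet G E) {u v : V} (hu : u ∈ closedNhd G E)
    (hv : v ∈ closedNhd G E) : Linked G E u v := by
  have aux : ∀ x ∈ E, ∀ w ∈ closedNhd G E, Linked G E w x := by
    intro x hx w hw
    rcases mem_closedNhd.1 hw with hw | ⟨d, hd, hdw⟩
    · exact hE w hw x hx
    · exact (Linked.cons hdw.symm (hE d hd x hx)).mono (by simp [hd])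
  rcases mem_closedNhd.1 hv with hv | ⟨d, hd, hdv⟩
  · exact aux v hv u hu
  · exact (Linked.cons hdv.symm (aux d hd u hu).symm).symm.mono
      (by simp [hd])

lemma connSet_insert {D : Finset V} (hD : ConnSet G D) {a : V} (ha : a ∈ closedNhd G D) :
    ConnSet G (insert a D) := by
  have hsub : ∀ x ∈ insert a D, x ∈ closedNhd G D := by
    intro x hx
    rcases Finset.mem_insert.1 hx with rfl | hx
    · exact ha
    · exact subset_closedNhd D hx
  exact fun x hx y hy => (hD.linked (hsub x hx) (hsub y hy)).mono (Finset.subset_insert _ _)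

/-- A connected set has a vertex, other than a given one, that does not separate it. -/
lemma ConnSet.exists_erase {D : Finset V} (hD : ConnSet G D) {x : V} (hx : x ∈ D)
    (h2 : 2 ≤ D.card) : ∃ l ∈ D, l ≠ x ∧ ConnSet G (D.erase l) := by
  have hxs : ({x} : Finset V) ∈
      D.powerset.filter fun E => x ∈ E ∧ E ≠ D ∧ ConnSet G E := by
    simp only [Finset.mem_filter, Finset.mem_powerset, Finset.singleton_subset_iff,
      Finset.mem_singleton, true_and]
    refine ⟨hx, ?_, connSet_singleton x⟩
    rintro rfl
    simp at h2
  obtain ⟨E, hE, hmax⟩ := Finset.exists_max_image _ Finset.card ⟨_, hxs⟩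
  simp only [Finset.mem_filter, Finset.mem_powerset] at hE hmax
  obtain ⟨hED, hxE, hne, hEc⟩ := hE
  obtain ⟨z, hzD, hzE⟩ := Finset.exists_of_ssubset (hED.ssubset_of_ne hne)
  obtain ⟨p, hp⟩ := hD x hx z hzD
  obtain ⟨d, hd, hd1, hd2⟩ := p.exists_boundary_dart (E : Set V) hxE hzE
  have hyD : d.snd ∈ D := by
    rcases hp _ (p.dart_snd_mem_support_of_mem_darts hd) with h | h | h
    · rwa [h]
    · rwa [h]
    · exact h
  have hy : d.snd ∉ E := hd2
  have hins : insert d.snd E = D := by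
    by_contra hcon
    have := hmax (insert d.snd E) ⟨Finset.insert_subset hyD hED, by simp [hxE], hcon,
      connSet_insert hEc (mem_closedNhd_of_adj hd1 d.adj)⟩
    rw [Finset.card_insert_of_notMem hy] at this
    omega
  refine ⟨d.snd, hyD, ?_, ?_⟩
  · intro h
    exact hy (h ▸ hxE)
  · rw [← hins, Finset.erase_insert hy]
    exact hEc

lemma privNhd_anti {D E L : Finset V} (h : D ⊆ E) : privNhd G E L ⊆ privNhd G D L := by
  intro v hv
  rw [mem_privNhd] at hv ⊢
  obtain ⟨l, hl, hlv, hv⟩ := hv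
  exact ⟨l, hl, hlv, fun h' => hv (closedNhd_mono (Finset.erase_subset_erase l h) h')⟩

/-- Connected vertex sets that dominate enough vertices, with few private neighbors. -/
structure Good (G : SimpleGraph V) (D : Finset V) : Prop where
  nonempty : D.Nonempty
  conn : ConnSet G D
  card_le : 2 * D.card + 4 ≤ (closedNhd G D).card
  priv_le : 2 ≤ D.card → ∀ L ⊆ D,
    (privNhd G D L).card + 2 * D.card + 4 ≤ (closedNhd G D).card + 4 * L.card

lemma closedNhd_singleton (x : V) :
    closedNhd G {x} = insert x (Finset.univ.filter (G.Adj x)) := by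
  ext v
  simp [mem_closedNhd]

lemma card_closedNhd_singleton (x : V) :
    (closedNhd G {x}).card = (Finset.univ.filter (G.Adj x)).card + 1 := by
  rw [closedNhd_singleton, Finset.card_insert_of_notMem (by simp)]

lemma good_singleton {x : V} (h : 5 ≤ (Finset.univ.filter (G.Adj x)).card) : Good G {x} where
  nonempty := Finset.singleton_nonempty x
  conn := connSet_singleton x
  card_le := by
    rw [card_closedNhd_singleton, Finset.card_singleton]
    omega
  priv_le := by simp

lemma Good.union {D S : Finset V} (hD : Good G D) (hDS : Disjoint D S)
    (hconn : ConnSet G (D ∪ S)) (hadj : ∃ d ∈ D, ∃ y ∈ S, G.Adj d y)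
    (hcard : (closedNhd G D).card + 2 * S.card ≤ (closedNhd G (D ∪ S)).card)
    (hS : 2 * S.card ≤ 4 + (S \ closedNhd G D).card) : Good G (D ∪ S) := by
  have hcu : (D ∪ S).card = D.card + S.card := Finset.card_union_of_disjoint hDS
  have hbase := hD.card_le
  have hold : ∀ L ⊆ D,
      (privNhd G (D ∪ S) L).card + 2 * D.card + 4 ≤ (closedNhd G D).card + 4 * L.card := by
    intro L hL
    by_cases h2 : 2 ≤ D.card
    · have := hD.priv_le h2 L hL
      have := Finset.card_le_card (privNhd_anti (G := G) (L := L)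
        (Finset.subset_union_left (s₁ := D) (s₂ := S)))
      omega
    · have h1 : D.card = 1 := by
        have := hD.nonempty.card_pos
        omega
      obtain ⟨x, rfl⟩ := Finset.card_eq_one.1 h1
      obtain ⟨d, hd, y, hy, hdy⟩ := hadj
      rw [Finset.mem_singleton] at hd
      subst hd
      rcases Finset.subset_singleton_iff.1 hL with rfl | rfl
      · have : privNhd G ({d} ∪ S) ∅ = ∅ := by
          ext v
          simp [mem_privNhd]
        rw [this]
        simp only [Finset.card_empty, Finset.card_singleton] at *
        omega
      · have hsub : privNhd G ({d} ∪ S) {d} ⊆ ((closedNhd G {d}).erase d).erase y := by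
          intro v hv
          obtain ⟨l, hl, hlv, hv⟩ := mem_privNhd.1 hv
          rw [Finset.mem_singleton] at hl
          subst hl
          refine Finset.mem_erase.2 ⟨?_, Finset.mem_erase.2 ⟨hlv.ne', ?_⟩⟩
          · rintro rfl
            exact hv (subset_closedNhd _ (by simp [hy, hlv.ne']))
          · exact mem_closedNhd_of_adj (by simp) hlv
        have := Finset.card_le_card hsub
        rw [Finset.card_erase_of_mem, Finset.card_erase_of_mem] at this
        · simp only [Finset.card_singleton] at *
          omega
        · exact subset_closedNhd _ (by simp)
        · exact Finset.mem_erase.2 ⟨hdy.ne', mem_closedNhd_of_adj (by simp) hdy⟩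
  refine ⟨hD.nonempty.mono Finset.subset_union_left, hconn, by omega, fun _ L hL => ?_⟩
  have hsplit : privNhd G (D ∪ S) L ⊆
      privNhd G (D ∪ S) (L ∩ D) ∪ privNhd G (D ∪ S) (L \ D) := by
    intro v hv
    obtain ⟨l, hl, h⟩ := mem_privNhd.1 hv
    by_cases hlD : l ∈ D
    · exact Finset.mem_union_left _ (mem_privNhd.2 ⟨l, by simp [hl, hlD], h⟩)
    · exact Finset.mem_union_right _ (mem_privNhd.2 ⟨l, by simp [hl, hlD], h⟩)
  have h1 := (Finset.card_le_card hsplit).trans (Finset.card_union_le _ _)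
  have h2 := hold (L ∩ D) Finset.inter_subset_right
  have h3 : (L ∩ D).card + (L \ D).card = L.card := Finset.card_inter_add_card_sdiff L D
  rcases (L \ D).eq_empty_or_nonempty with he | hne
  · have : privNhd G (D ∪ S) (L \ D) = ∅ := by
      rw [he]
      ext v
      simp [mem_privNhd]
    rw [this, Finset.card_empty] at h1
    omega
  · have hpos := hne.card_pos
    have hnew : ∀ v ∈ privNhd G (D ∪ S) (L \ D),
        v ∉ closedNhd G D ∧ v ∉ S ∧ v ∈ closedNhd G (D ∪ S) := by
      intro v hv
      obtain ⟨l, hl, hlv, hv⟩ := mem_privNhd.1 hv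
      rw [Finset.mem_sdiff] at hl
      refine ⟨fun h => hv (closedNhd_mono ?_ h), fun h => hv (subset_closedNhd _ ?_),
        mem_closedNhd_of_adj (hL hl.1) hlv⟩
      · exact Finset.subset_erase.2 ⟨Finset.subset_union_left, hl.2⟩
      · simp [h, hlv.ne']
    have hdis1 : Disjoint (privNhd G (D ∪ S) (L \ D)) (S \ closedNhd G D) :=
      Finset.disjoint_left.2 fun v hv h => (hnew v hv).2.1 (Finset.mem_sdiff.1 h).1
    have hdis2 : Disjoint (privNhd G (D ∪ S) (L \ D) ∪ S \ closedNhd G D) (closedNhd G D) := by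
      refine Finset.disjoint_left.2 fun v hv h => ?_
      rcases Finset.mem_union.1 hv with hv | hv
      · exact (hnew v hv).1 h
      · exact (Finset.mem_sdiff.1 hv).2 h
    have hsub : privNhd G (D ∪ S) (L \ D) ∪ S \ closedNhd G D ∪ closedNhd G D ⊆
        closedNhd G (D ∪ S) := by
      refine Finset.union_subset (Finset.union_subset (fun v hv => (hnew v hv).2.2) ?_)
        (closedNhd_mono Finset.subset_union_left)
      exact Finset.sdiff_subset.trans (Finset.subset_union_right.trans (subset_closedNhd _))
    have h4 := Finset.card_le_card hsub
    rw [Finset.card_union_of_disjoint hdis2, Finset.card_union_of_disjoint hdis1] at h4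
    omega

/-- The neighbors of `r` dominated by `D`. -/
noncomputable def nearNhd (G : SimpleGraph V) (D : Finset V) (r : V) : Finset V :=
  (closedNhd G D).filter (G.Adj r)

/-- The neighbors of `r` not dominated by `D`. -/
noncomputable def farNhd (G : SimpleGraph V) (D : Finset V) (r : V) : Finset V :=
  (closedNhd G D)ᶜ.filter (G.Adj r)

lemma mem_nearNhd {D : Finset V} {r v : V} :
    v ∈ nearNhd G D r ↔ v ∈ closedNhd G D ∧ G.Adj r v := by
  simp [nearNhd]

lemma mem_farNhd {D : Finset V} {r v : V} :
    v ∈ farNhd G D r ↔ v ∉ closedNhd G D ∧ G.Adj r v := by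
  simp [farNhd]

lemma card_nearNhd_add_card_farNhd (D : Finset V) (r : V) :
    (nearNhd G D r).card + (farNhd G D r).card = (Finset.univ.filter (G.Adj r)).card := by
  rw [← Finset.card_union_of_disjoint]
  · congr 1
    ext v
    simp only [Finset.mem_union, mem_nearNhd, mem_farNhd, Finset.mem_filter, Finset.mem_univ,
      true_and]
    tauto
  · refine Finset.disjoint_left.2 fun v hv h => ?_
    exact (mem_farNhd.1 h).1 (mem_nearNhd.1 hv).1

lemma notMem_of_adj {D : Finset V} {a r : V} (hr : r ∉ closedNhd G D) (h : G.Adj a r) :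
    a ∉ D :=
  fun ha => hr (mem_closedNhd_of_adj ha h)

lemma exists_good (hG : G.Connected) (hδ : ∀ v, 5 ≤ (Finset.univ.filter (G.Adj v)).card) :
    ∃ D, Good G D ∧
      (∀ a ∈ closedNhd G D, ∀ r ∉ closedNhd G D, ∀ s ∉ closedNhd G D,
        G.Adj a r → G.Adj a s → r = s) ∧
      ∀ r ∉ closedNhd G D, (farNhd G D r).card ≤ 2 := by
  obtain ⟨x₀⟩ := hG.nonempty
  obtain ⟨D, hD, hmax⟩ := Finset.exists_max_image (Finset.univ.filter (Good G)) Finset.card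
    ⟨{x₀}, by simpa using good_singleton (hδ x₀)⟩
  simp only [Finset.mem_filter, Finset.mem_univ, true_and] at hD hmax
  have hext : ∀ S, S.Nonempty → Disjoint D S → ConnSet G (D ∪ S) →
      (∃ d ∈ D, ∃ y ∈ S, G.Adj d y) →
      (closedNhd G D).card + 2 * S.card ≤ (closedNhd G (D ∪ S)).card →
      2 * S.card ≤ 4 + (S \ closedNhd G D).card → False := by
    intro S hne hdis hconn hadj hcard hS
    have := hmax _ (hD.union hdis hconn hadj hcard hS)
    rw [Finset.card_union_of_disjoint hdis] at this
    have := hne.card_pos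
    omega
  have hgain : ∀ S A : Finset V, (∀ v ∈ A, v ∉ closedNhd G D) → (∀ v ∈ A, v ∈ closedNhd G (D ∪ S)) →
      (closedNhd G D).card + A.card ≤ (closedNhd G (D ∪ S)).card := by
    intro S A h1 h2
    rw [← Finset.card_union_of_disjoint (Finset.disjoint_right.2 h1)]
    exact Finset.card_le_card (Finset.union_subset (closedNhd_mono Finset.subset_union_left) h2)
  have hfront : ∀ a ∈ closedNhd G D, a ∉ D → ∃ d ∈ D, G.Adj d a :=
    fun a ha haD => (mem_closedNhd.1 ha).resolve_left haD
  have hnear : ∀ r, r ∉ closedNhd G D → ∃ a ∈ closedNhd G D, G.Adj a r := by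
    intro r hr
    by_contra hno
    have hrT : r ∉ closedNhd G (closedNhd G D) := by
      intro h
      exact hno ((mem_closedNhd.1 h).resolve_left hr)
    obtain ⟨z, hz⟩ := hD.nonempty
    obtain ⟨p⟩ := hG.preconnected z r
    obtain ⟨e, -, he1, he2⟩ := p.exists_boundary_dart (closedNhd G (closedNhd G D) : Set V)
      (subset_closedNhd _ (subset_closedNhd _ hz)) hrT
    obtain ⟨⟨b, x⟩, hbx⟩ := e
    simp only [Finset.mem_coe] at he1 he2
    change G.Adj b x at hbx
    have hb : b ∉ closedNhd G D := fun h => he2 (mem_closedNhd_of_adj h hbx)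
    obtain ⟨a, ha, hab⟩ := (mem_closedNhd.1 he1).resolve_left hb
    have haD := notMem_of_adj hb hab
    have hx : x ∉ closedNhd G D := fun h => he2 (subset_closedNhd _ h)
    have hax : a ≠ x := by
      rintro rfl
      exact hx ha
    have hxN : ∀ v, G.Adj x v → v ∉ closedNhd G D :=
      fun v hv h => he2 (mem_closedNhd_of_adj h hv.symm)
    obtain ⟨d, hd, hda⟩ := hfront a ha haD
    have hcard3 : ({a, b, x} : Finset V).card = 3 :=
      Finset.card_eq_three.2 ⟨a, b, x, hab.ne, hax, hbx.ne, rfl⟩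
    have hun : D ∪ {a, b, x} = insert x (insert b (insert a D)) := by
      ext v
      simp only [Finset.mem_union, Finset.mem_insert, Finset.mem_singleton]
      tauto
    refine hext {a, b, x} ⟨a, by simp⟩ ?_ ?_ ⟨d, hd, a, by simp, hda⟩ ?_ ?_
    · refine Finset.disjoint_right.2 fun v hv => ?_
      simp only [Finset.mem_insert, Finset.mem_singleton] at hv
      rcases hv with rfl | rfl | rfl
      · exact haD
      · exact fun h => hb (subset_closedNhd _ h)
      · exact fun h => hx (subset_closedNhd _ h)
    · rw [hun]
      refine connSet_insert (connSet_insert (connSet_insert hD.conn ha) ?_) ?_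
      · exact mem_closedNhd_of_adj (by simp) hab
      · exact mem_closedNhd_of_adj (by simp) hbx
    · have := hgain {a, b, x} (closedNhd G {x}) (fun v hv => ?_)
        (closedNhd_mono (by simp [Finset.subset_iff]))
      · rw [card_closedNhd_singleton] at this
        have := hδ x
        omega
      · rcases mem_closedNhd.1 hv with hv | ⟨d, hd, hdv⟩
        · rw [Finset.mem_singleton.1 hv]
          exact hx
        · rw [Finset.mem_singleton] at hd
          subst hd
          exact hxN v hdv
    · have : ({b, x} : Finset V).card ≤ ({a, b, x} \ closedNhd G D : Finset V).card := by
        refine Finset.card_le_card fun v hv => ?_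
        simp only [Finset.mem_insert, Finset.mem_singleton] at hv
        rcases hv with rfl | rfl <;> simp [hb, hx]
      rw [Finset.card_pair hbx.ne] at this
      omega
  refine ⟨D, hD, ?_, ?_⟩
  · intro a ha r hr s hs har has
    by_contra hrs
    have haD := notMem_of_adj hr har
    obtain ⟨d, hd, hda⟩ := hfront a ha haD
    refine hext {a} ⟨a, by simp⟩ (by simpa using haD) ?_ ⟨d, hd, a, by simp, hda⟩ ?_
      (by rw [Finset.card_singleton]; omega)
    · rw [Finset.union_comm, ← Finset.insert_eq]
      exact connSet_insert hD.conn ha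
    · have := hgain {a} {r, s} (by simp [hr, hs]) (fun v hv => ?_)
      · rw [Finset.card_pair hrs] at this
        simpa using this
      · simp only [Finset.mem_insert, Finset.mem_singleton] at hv
        rcases hv with rfl | rfl
        · exact mem_closedNhd_of_adj (by simp) har
        · exact mem_closedNhd_of_adj (by simp) has
  · intro r hr
    by_contra hfar
    obtain ⟨a, ha, har⟩ := hnear r hr
    have haD := notMem_of_adj hr har
    obtain ⟨d, hd, hda⟩ := hfront a ha haD
    have hun : D ∪ {a, r} = insert r (insert a D) := by
      ext v
      simp only [Finset.mem_union, Finset.mem_insert, Finset.mem_singleton]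
      tauto
    have hcard2 : ({a, r} : Finset V).card = 2 := Finset.card_pair har.ne
    refine hext {a, r} ⟨a, by simp⟩ ?_ ?_ ⟨d, hd, a, by simp, hda⟩ ?_ (by omega)
    · refine Finset.disjoint_right.2 fun v hv => ?_
      simp only [Finset.mem_insert, Finset.mem_singleton] at hv
      rcases hv with rfl | rfl
      · exact haD
      · exact fun h => hr (subset_closedNhd _ h)
    · rw [hun]
      exact connSet_insert (connSet_insert hD.conn ha) (mem_closedNhd_of_adj (by simp) har)
    · have := hgain {a, r} (insert r (farNhd G D r)) (fun v hv => ?_) (fun v hv => ?_)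
      · rw [Finset.card_insert_of_notMem (by simp [mem_farNhd])] at this
        omega
      · rcases Finset.mem_insert.1 hv with rfl | hv
        · exact hr
        · exact (mem_farNhd.1 hv).1
      · rcases Finset.mem_insert.1 hv with rfl | hv
        · exact subset_closedNhd _ (by simp)
        · exact mem_closedNhd_of_adj (by simp) (mem_farNhd.1 hv).2

/-- Vertices outside the closed neighborhood of `D` share no dominated neighbor. -/
def PrivateFront (G : SimpleGraph V) (D : Finset V) : Prop :=
  ∀ a ∈ closedNhd G D, ∀ r ∉ closedNhd G D, ∀ s ∉ closedNhd G D,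
    G.Adj a r → G.Adj a s → r = s

lemma exists_coloring {D : Finset V} (hD : D.Nonempty) (hfront : PrivateFront G D) {f : V → ℕ}
    {k : ℕ} (hDk : D.card ≤ k) (hf : ∀ v ∈ D, f v < D.card) {h : V → V → ℕ}
    (hh : ∀ r ∉ closedNhd G D, ∀ v, h r v < k) :
    ∃ c : V → ℕ, (∀ v, c v < k) ∧ (∀ v ∈ D, c v = f v) ∧
      ∀ r ∉ closedNhd G D, ∀ v ∈ nearNhd G D r, c v = h r v := by
  have hk : 0 < k := hD.card_pos.trans_le hDk
  refine ⟨fun v => if v ∈ D then f v else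
    if hv : ∃ r, r ∉ closedNhd G D ∧ G.Adj r v then h hv.choose v else 0, ?_, ?_, ?_⟩
  · intro v
    dsimp only
    split_ifs with h1 h2
    · exact (hf v h1).trans_le hDk
    · exact hh _ h2.choose_spec.1 v
    · exact hk
  · intro v hv
    simp [hv]
  · intro r hr v hv
    rw [mem_nearNhd] at hv
    have hex : ∃ r, r ∉ closedNhd G D ∧ G.Adj r v := ⟨r, hr, hv.2⟩
    have heq : hex.choose = r :=
      hfront v hv.1 _ hex.choose_spec.1 r hr hex.choose_spec.2.symm hv.2.symm
    simp only [notMem_of_adj hr hv.2.symm, if_false, dif_pos hex, heq]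

lemma rvc_le_of_closedNhd {D : Finset V} (hconn : ConnSet G D) {c : V → ℕ} {k : ℕ}
    (hc : ∀ v, c v < k) (hinj : Set.InjOn c D)
    (h₁ : ∀ r ∉ closedNhd G D, ∀ v ∈ closedNhd G D,
      ∃ W : Finset V, Set.InjOn c W ∧ Linked G W r v)
    (h₂ : ∀ r ∉ closedNhd G D, ∀ s ∉ closedNhd G D, r ≠ s →
      ∃ W : Finset V, Set.InjOn c W ∧ Linked G W r s) : rvc G ≤ k := by
  refine rvc_le_of_linked hc fun u v => ?_
  by_cases hu : u ∈ closedNhd G D <;> by_cases hv : v ∈ closedNhd G D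
  · exact ⟨D, hinj, hconn.linked hu hv⟩
  · obtain ⟨W, hW, hl⟩ := h₁ v hv u hu
    exact ⟨W, hW, hl.symm⟩
  · exact h₁ u hu v hv
  · by_cases huv : u = v
    · subst huv
      exact ⟨∅, by simp, Linked.refl _ _⟩
    · exact h₂ u hu v hv huv

lemma rvc_le_card_add_two {D : Finset V} (hD : D.Nonempty) (hconn : ConnSet G D)
    (hfront : PrivateFront G D) (hnear : ∀ r ∉ closedNhd G D, 2 ≤ (nearNhd G D r).card) :
    rvc G ≤ D.card + 2 := by
  obtain ⟨f, hfinj, hf⟩ := exists_numbering D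
  have hpick : ∀ r, ∃ h : V → ℕ, (∀ v, h v < D.card + 2) ∧ (r ∉ closedNhd G D →
      (∃ a ∈ nearNhd G D r, h a = D.card) ∧ ∃ b ∈ nearNhd G D r, h b = D.card + 1) := by
    intro r
    by_cases hr : r ∈ closedNhd G D
    · exact ⟨fun _ => 0, by simp, fun h => absurd hr h⟩
    · obtain ⟨a, ha, b, hb, hab⟩ := Finset.one_lt_card.1 (hnear r hr)
      refine ⟨fun v => if v = a then D.card else D.card + 1, ?_,
        fun _ => ⟨⟨a, ha, by simp⟩, b, hb, by simp [hab.symm]⟩⟩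
      intro v
      dsimp only
      split_ifs <;> omega
  choose h hh hpick using hpick
  obtain ⟨c, hck, hcD, hch⟩ := exists_coloring hD hfront (Nat.le_add_right _ 2) hf
    (fun r _ => hh r)
  have hclt : ∀ v ∈ D, c v < D.card := fun v hv => (hcD v hv).trans_lt (hf v hv)
  have hcinj : Set.InjOn c D := hfinj.congr fun v hv => (hcD v hv).symm
  refine rvc_le_of_closedNhd hconn hck hcinj ?_ ?_
  · intro r hr v hv
    obtain ⟨⟨a, ha, hha⟩, -⟩ := hpick r hr
    have hca := (hch r hr a ha).trans hha
    rw [mem_nearNhd] at ha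
    refine ⟨insert a D, injOn_insert hcinj fun w hw => ?_,
      Linked.cons ha.2 (hconn.linked ha.1 hv)⟩
    have := hclt w hw
    omega
  · intro r hr s hs _
    obtain ⟨⟨a, ha, hha⟩, -⟩ := hpick r hr
    obtain ⟨-, b, hb, hhb⟩ := hpick s hs
    have hca := (hch r hr a ha).trans hha
    have hcb := (hch s hs b hb).trans hhb
    rw [mem_nearNhd] at ha hb
    refine ⟨insert a (insert b D), injOn_insert (injOn_insert hcinj fun w hw => ?_) fun w hw => ?_,
      Linked.cons ha.2 (Linked.cons hb.2 (hconn.linked hb.1 ha.1)).symm⟩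
    · have := hclt w hw
      omega
    · rcases Finset.mem_insert.1 hw with rfl | hw
      · omega
      · have := hclt w hw
        omega

/-- Every dominated vertex can be reached from `s` through a neighbor of `s` and a connected part
of `D` avoiding the color that `h` gives to this neighbor. -/
def Flexible (G : SimpleGraph V) (D : Finset V) (f : V → ℕ) (s : V) (h : V → ℕ) : Prop :=
  ∀ v ∈ closedNhd G D, ∃ a ∈ nearNhd G D s, ∃ E ⊆ D, ConnSet G E ∧ a ∈ closedNhd G E ∧
    v ∈ closedNhd G E ∧ h a < D.card ∧ ∀ w ∈ E, f w ≠ h a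

lemma rvc_le_card {D : Finset V} (hD : D.Nonempty) (hconn : ConnSet G D)
    (hfront : PrivateFront G D) {f : V → ℕ} (hfinj : Set.InjOn f D)
    (hf : ∀ v ∈ D, f v < D.card)
    (hsub : ∀ r ∉ closedNhd G D, ∀ s ∉ closedNhd G D, r = s)
    (hflex : ∀ r ∉ closedNhd G D, ∃ h : V → ℕ, (∀ v, h v < D.card) ∧ Flexible G D f r h) :
    rvc G ≤ D.card := by
  choose! h hh hflex using hflex
  obtain ⟨c, hck, hcD, hch⟩ := exists_coloring hD hfront le_rfl hf hh
  have hcinj : Set.InjOn c D := hfinj.congr fun v hv => (hcD v hv).symm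
  refine rvc_le_of_closedNhd hconn hck hcinj ?_ fun r hr s hs hrs => absurd (hsub r hr s hs) hrs
  intro r hr v hv
  obtain ⟨a, ha, E, hED, hE, haE, hvE, -, hw⟩ := hflex r hr v hv
  refine ⟨insert a E, injOn_insert (hcinj.mono (Finset.coe_subset.2 hED)) fun w hwE => ?_,
    Linked.cons (mem_nearNhd.1 ha).2 (hE.linked haE hvE)⟩
  rw [hcD w (hED hwE), hch r hr a ha]
  exact hw w hwE

lemma rvc_le_card_add_one {D : Finset V} (hD : D.Nonempty) (hconn : ConnSet G D)
    (hfront : PrivateFront G D) {f : V → ℕ} (hfinj : Set.InjOn f D)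
    (hf : ∀ v ∈ D, f v < D.card) {Fl : V → Prop}
    (hpair : ∀ r ∉ closedNhd G D, ∀ s ∉ closedNhd G D, r ≠ s →
      G.Adj r s ∨ (∃ w, G.Adj r w ∧ G.Adj w s) ∨ Fl r ∨ Fl s)
    (hflex : ∀ r ∉ closedNhd G D, ∃ h : V → ℕ, (∀ v, h v < D.card + 1) ∧
      (∃ m ∈ nearNhd G D r, h m = D.card) ∧ (Fl r → Flexible G D f r h)) :
    rvc G ≤ D.card + 1 := by
  choose! h hh hex hflex using hflex
  choose! m hm hhm using hex
  obtain ⟨c, hck, hcD, hch⟩ := exists_coloring hD hfront (Nat.le_add_right _ 1) hf hh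
  have hclt : ∀ v ∈ D, c v < D.card := fun v hv => (hcD v hv).trans_lt (hf v hv)
  have hcinj : Set.InjOn c D := hfinj.congr fun v hv => (hcD v hv).symm
  have hcm : ∀ r ∉ closedNhd G D, c (m r) = D.card :=
    fun r hr => (hch r hr _ (hm r hr)).trans (hhm r hr)
  have hone : ∀ r ∉ closedNhd G D, ∀ s ∉ closedNhd G D, Fl s →
      ∃ W : Finset V, Set.InjOn c W ∧ Linked G W r s := by
    intro r hr s hs hFl
    have hmr := mem_nearNhd.1 (hm r hr)
    obtain ⟨a, ha, E, hED, hE, haE, hvE, hlt, hw⟩ := hflex s hs hFl (m r) hmr.1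
    have hca := hch s hs a ha
    have hcr := hcm r hr
    refine ⟨insert (m r) (insert a E),
      injOn_insert (injOn_insert (hcinj.mono (Finset.coe_subset.2 hED)) ?_) ?_,
      Linked.cons hmr.2 (Linked.cons (mem_nearNhd.1 ha).2 (hE.linked haE hvE)).symm⟩
    · intro w hwE
      rw [hcD w (hED hwE), hca]
      exact hw w hwE
    · intro w hwE
      rcases Finset.mem_insert.1 hwE with rfl | hwE
      · omega
      · have := hclt w (hED hwE)
        omega
  refine rvc_le_of_closedNhd hconn hck hcinj ?_ ?_
  · intro r hr v hv
    have hmr := mem_nearNhd.1 (hm r hr)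
    have hcr := hcm r hr
    refine ⟨insert (m r) D, injOn_insert hcinj fun w hw => ?_,
      Linked.cons hmr.2 (hconn.linked hmr.1 hv)⟩
    have := hclt w hw
    omega
  · intro r hr s hs hrs
    rcases hpair r hr s hs hrs with h | ⟨w, hrw, hws⟩ | h | h
    · exact ⟨∅, by simp, Linked.of_adj _ h⟩
    · exact ⟨{w}, by simp, Linked.cons hrw (Linked.of_adj ∅ hws)⟩
    · obtain ⟨W, hW, hl⟩ := hone s hs r hr h
      exact ⟨W, hW, hl.symm⟩
    · exact hone r hr s hs h

lemma mem_closedNhd_erase_or {D : Finset V} {l₁ l₂ v : V} (hl : l₁ ≠ l₂)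
    (hv : v ∈ closedNhd G D) :
    v ∈ closedNhd G (D.erase l₁) ∨ v ∈ closedNhd G (D.erase l₂) := by
  have aux : ∀ d ∈ D, d ∈ D.erase l₁ ∨ d ∈ D.erase l₂ := by
    intro d hd
    by_cases h : d = l₁
    · exact Or.inr (Finset.mem_erase.2 ⟨h ▸ hl, hd⟩)
    · exact Or.inl (Finset.mem_erase.2 ⟨h, hd⟩)
  rcases mem_closedNhd.1 hv with hv | ⟨d, hd, hdv⟩
  · exact (aux v hv).imp (fun h => subset_closedNhd _ h) fun h => subset_closedNhd _ h
  · exact (aux d hd).imp (fun h => mem_closedNhd_of_adj h hdv) fun h => mem_closedNhd_of_adj h hdv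

/-- The vertex `s` has different dominated neighbors, one with a dominator other than `l₁` and one
with a dominator other than `l₂`. -/
def Splits (G : SimpleGraph V) (D : Finset V) (l₁ l₂ s : V) : Prop :=
  ∃ a ∈ nearNhd G D s, ∃ b ∈ nearNhd G D s, a ≠ b ∧ a ∈ closedNhd G (D.erase l₁) ∧
    b ∈ closedNhd G (D.erase l₂)

lemma Splits.exists_flexible {D : Finset V} {l₁ l₂ s : V} (hs : Splits G D l₁ l₂ s)
    (hl₁ : l₁ ∈ D) (hl₂ : l₂ ∈ D) (hl : l₁ ≠ l₂) (hc₁ : ConnSet G (D.erase l₁))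
    (hc₂ : ConnSet G (D.erase l₂)) {f : V → ℕ} (hfinj : Set.InjOn f D)
    (hf : ∀ v ∈ D, f v < D.card) (hcard : 3 ≤ (nearNhd G D s).card) (z : ℕ) :
    ∃ h : V → ℕ, (∀ v, h v < D.card ∨ h v = z) ∧ (∃ m ∈ nearNhd G D s, h m = z) ∧
      Flexible G D f s h := by
  obtain ⟨a, ha, b, hb, hab, haE, hbE⟩ := hs
  obtain ⟨m, hm, hmab⟩ : ∃ m ∈ nearNhd G D s, m ∉ ({a, b} : Finset V) := by
    refine Finset.exists_mem_notMem_of_card_lt_card ?_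
    rw [Finset.card_pair hab]
    omega
  simp only [Finset.mem_insert, Finset.mem_singleton, not_or] at hmab
  refine ⟨fun v => if v = a then f l₁ else if v = b then f l₂ else z, ?_,
    ⟨m, hm, by simp [hmab.1, hmab.2]⟩, ?_⟩
  · intro v
    dsimp only
    split_ifs
    · exact Or.inl (hf _ hl₁)
    · exact Or.inl (hf _ hl₂)
    · exact Or.inr rfl
  · have hne : ∀ l ∈ D, ∀ w ∈ D.erase l, f w ≠ f l := by
      intro l hlD w hw h
      rw [Finset.mem_erase] at hw
      exact hw.1 (hfinj hw.2 hlD h)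
    intro v hv
    rcases mem_closedNhd_erase_or hl hv with hv | hv
    · refine ⟨a, ha, D.erase l₁, Finset.erase_subset _ _, hc₁, haE, hv, ?_⟩
      simp only [if_true]
      exact ⟨hf _ hl₁, hne _ hl₁⟩
    · refine ⟨b, hb, D.erase l₂, Finset.erase_subset _ _, hc₂, hbE, hv, ?_⟩
      simp only [hab.symm, if_true, if_false]
      exact ⟨hf _ hl₂, hne _ hl₂⟩

lemma nearNhd_subset_privNhd {D : Finset V} {l₁ l₂ s : V} (hs : s ∉ closedNhd G D)
    (hl : l₁ ≠ l₂) (hcard : 2 ≤ (nearNhd G D s).card) (hns : ¬ Splits G D l₁ l₂ s) :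
    nearNhd G D s ⊆ privNhd G D {l₁} ∨ nearNhd G D s ⊆ privNhd G D {l₂} := by
  have hpriv : ∀ l, (∀ v ∈ nearNhd G D s, v ∉ closedNhd G (D.erase l)) →
      nearNhd G D s ⊆ privNhd G D {l} := by
    intro l h v hv
    have hv' := mem_nearNhd.1 hv
    obtain ⟨d, hd, hdv⟩ := (mem_closedNhd.1 hv'.1).resolve_left (notMem_of_adj hs hv'.2.symm)
    have hdl : d = l := by
      by_contra hdl
      exact h v hv (mem_closedNhd_of_adj (Finset.mem_erase.2 ⟨hdl, hd⟩) hdv)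
    subst hdl
    exact mem_privNhd.2 ⟨d, by simp, hdv, h v hv⟩
  by_contra! hcon
  have h₁ := mt (hpriv l₁) hcon.1
  have h₂ := mt (hpriv l₂) hcon.2
  push Not at h₁ h₂
  obtain ⟨a, ha, haE⟩ := h₁
  obtain ⟨b, hb, hbE⟩ := h₂
  by_cases hab : a = b
  · subst hab
    obtain ⟨e, he, hea⟩ := Finset.exists_mem_ne hcard a
    rcases mem_closedNhd_erase_or hl (mem_nearNhd.1 he).1 with h | h
    · exact hns ⟨e, he, a, ha, hea, h, hbE⟩
    · exact hns ⟨a, ha, e, he, hea.symm, haE, h⟩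
  · exact hns ⟨a, ha, b, hb, hab, haE, hbE⟩

lemma disjoint_nearNhd {D : Finset V} (hfront : PrivateFront G D) {r s : V}
    (hr : r ∉ closedNhd G D) (hs : s ∉ closedNhd G D) (hrs : r ≠ s) :
    Disjoint (nearNhd G D r) (nearNhd G D s) := by
  refine Finset.disjoint_left.2 fun v hv hv' => hrs ?_
  rw [mem_nearNhd] at hv hv'
  exact hfront v hv.1 r hr s hs hv.2.symm hv'.2.symm

lemma privNhd_mono {D L L' : Finset V} (h : L ⊆ L') : privNhd G D L ⊆ privNhd G D L' := by
  intro v hv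
  obtain ⟨l, hl, hlv⟩ := mem_privNhd.1 hv
  exact mem_privNhd.2 ⟨l, h hl, hlv⟩

lemma two_mul_rvc_add_four_le_of_two_le {D : Finset V} (hD : Good G D)
    (hδ : ∀ v, 5 ≤ (Finset.univ.filter (G.Adj v)).card) (hfront : PrivateFront G D)
    (hfar : ∀ r ∉ closedNhd G D, (farNhd G D r).card ≤ 2) (h2 : 2 ≤ D.card)
    (hsmall : Fintype.card V < 2 * D.card + 8) : 2 * rvc G + 4 ≤ Fintype.card V := by
  have hn := Finset.card_add_card_compl (closedNhd G D)
  have hle := hD.card_le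
  have hnear : ∀ r ∉ closedNhd G D, 3 ≤ (nearNhd G D r).card := by
    intro r hr
    have := card_nearNhd_add_card_farNhd (G := G) D r
    have := hδ r
    have := hfar r hr
    omega
  have hiso : ∀ r, farNhd G D r = ∅ → 5 ≤ (nearNhd G D r).card := by
    intro r hr
    have := card_nearNhd_add_card_farNhd (G := G) D r
    rw [hr, Finset.card_empty] at this
    have := hδ r
    omega
  obtain ⟨x, hx⟩ := hD.nonempty
  obtain ⟨l₁, hl₁, -, hc₁⟩ := hD.conn.exists_erase hx h2
  obtain ⟨l₂, hl₂, hne, hc₂⟩ := hD.conn.exists_erase hl₁ h2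
  obtain ⟨f, hfinj, hf⟩ := exists_numbering D
  have hsplit : ∀ s ∉ closedNhd G D, farNhd G D s = ∅ →
      (closedNhd G D).card < 2 * D.card + 5 → Splits G D l₁ l₂ s := by
    intro s hs hfs hlt
    by_contra hns
    have h5 := hiso s hfs
    rcases nearNhd_subset_privNhd hs hne.symm (by omega) hns with h | h
    · have h6 := Finset.card_le_card h
      have := hD.priv_le h2 {l₁} (by simpa using hl₁)
      rw [Finset.card_singleton] at this
      omega
    · have h6 := Finset.card_le_card h
      have := hD.priv_le h2 {l₂} (by simpa using hl₂)
      rw [Finset.card_singleton] at this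
      omega
  by_cases h6 : 2 * D.card + 6 ≤ Fintype.card V
  · have := rvc_le_card_add_one (Fl := Splits G D l₁ l₂) hD.nonempty hD.conn hfront hfinj hf
      ?_ ?_
    · omega
    · intro r hr s hs hrs
      by_contra! hcon
      obtain ⟨hadj, hcommon, hnr, hns⟩ := hcon
      have hempty : ∀ r ∉ closedNhd G D, ∀ s ∉ closedNhd G D, r ≠ s → ¬ G.Adj r s →
          (∀ w, G.Adj r w → ¬ G.Adj w s) → ¬ Splits G D l₁ l₂ s → farNhd G D r = ∅ := by
        intro r hr s hs hrs hadj hcommon hns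
        by_contra hcon
        obtain ⟨w, hw⟩ := Finset.nonempty_iff_ne_empty.2 hcon
        rw [mem_farNhd] at hw
        have hws : w ≠ s := by
          rintro rfl
          exact hadj hw.2
        have h3 : ({r, s, w} : Finset V).card = 3 :=
          Finset.card_eq_three.2 ⟨r, s, w, hrs, hw.2.ne, hws.symm, rfl⟩
        have hsub : ({r, s, w} : Finset V) ⊆ (closedNhd G D)ᶜ := by
          intro v hv
          simp only [Finset.mem_insert, Finset.mem_singleton] at hv
          rw [Finset.mem_compl]
          rcases hv with rfl | rfl | rfl
          · exact hr
          · exact hs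
          · exact hw.1
        have hq := Finset.card_le_card hsub
        have heq := Finset.eq_of_subset_of_card_le hsub (by omega)
        refine hns (hsplit s hs ?_ (by omega))
        refine Finset.eq_empty_of_forall_notMem fun y hy => ?_
        rw [mem_farNhd] at hy
        have hy' := Finset.mem_compl.2 hy.1
        rw [← heq] at hy'
        simp only [Finset.mem_insert, Finset.mem_singleton] at hy'
        rcases hy' with rfl | rfl | rfl
        · exact hadj hy.2.symm
        · exact hy.2.ne rfl
        · exact hcommon y hw.2 hy.2.symm
      have hr5 := hiso r (hempty r hr s hs hrs hadj hcommon hns)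
      have hs5 := hiso s (hempty s hs r hr hrs.symm (fun h => hadj h.symm)
        (fun w h h' => hcommon w h'.symm h.symm) hnr)
      have hsub : ∀ s ∉ closedNhd G D, 5 ≤ (nearNhd G D s).card → ¬ Splits G D l₁ l₂ s →
          nearNhd G D s ⊆ privNhd G D {l₁, l₂} := by
        intro s hs h5 hns
        rcases nearNhd_subset_privNhd hs hne.symm (by omega) hns with h | h
        · exact h.trans (privNhd_mono (by simp))
        · exact h.trans (privNhd_mono (by simp))
      have h10 := Finset.card_le_card
        (Finset.union_subset (hsub r hr hr5 hnr) (hsub s hs hs5 hns))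
      rw [Finset.card_union_of_disjoint (disjoint_nearNhd hfront hr hs hrs)] at h10
      have hpriv := hD.priv_le h2 {l₁, l₂} (by simp [Finset.insert_subset_iff, hl₁, hl₂])
      rw [Finset.card_pair hne.symm] at hpriv
      have hq : ({r, s} : Finset V).card ≤ (closedNhd G D)ᶜ.card :=
        Finset.card_le_card (by simp [Finset.insert_subset_iff, hr, hs])
      rw [Finset.card_pair hrs] at hq
      omega
    · intro r hr
      by_cases hs : Splits G D l₁ l₂ r
      · obtain ⟨h, hh, hm, hflex⟩ := hs.exists_flexible hl₁ hl₂ hne.symm hc₁ hc₂ hfinj hf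
          (hnear r hr) D.card
        refine ⟨h, fun v => ?_, hm, fun _ => hflex⟩
        rcases hh v with h | h <;> omega
      · obtain ⟨m, hm⟩ := Finset.card_pos.1 (lt_of_lt_of_le (by omega) (hnear r hr))
        exact ⟨fun _ => D.card, by simp, ⟨m, hm, rfl⟩, fun h => absurd h hs⟩
  · have hsub : ∀ r ∉ closedNhd G D, ∀ s ∉ closedNhd G D, r = s := by
      intro r hr s hs
      exact Finset.card_le_one.1 (by omega) r (Finset.mem_compl.2 hr) s (Finset.mem_compl.2 hs)
    have := rvc_le_card hD.nonempty hD.conn hfront hfinj hf hsub ?_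
    · omega
    · intro r hr
      have hq : 0 < (closedNhd G D)ᶜ.card := Finset.card_pos.2 ⟨r, Finset.mem_compl.2 hr⟩
      have hfr : farNhd G D r = ∅ := by
        refine Finset.eq_empty_of_forall_notMem fun y hy => ?_
        rw [mem_farNhd] at hy
        exact hy.2.ne (hsub r hr y hy.1)
      obtain ⟨h, hh, -, hflex⟩ := (hsplit r hr hfr (by omega)).exists_flexible hl₁ hl₂ hne.symm
        hc₁ hc₂ hfinj hf (hnear r hr) 0
      refine ⟨h, fun v => ?_, hflex⟩
      rcases hh v with h | h <;> omega

lemma two_mul_rvc_add_four_le_of_singleton {x : V}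
    (hδ : ∀ v, 5 ≤ (Finset.univ.filter (G.Adj v)).card) (hfront : PrivateFront G {x})
    (hfar : ∀ r ∉ closedNhd G {x}, (farNhd G {x} r).card ≤ 2)
    (hout : ∃ r, r ∉ closedNhd G {x}) (hsmall : Fintype.card V < 10) :
    2 * rvc G + 4 ≤ Fintype.card V := by
  have hn := Finset.card_add_card_compl (closedNhd G {x})
  have hdeg := card_closedNhd_singleton (G := G) x
  have hx5 := hδ x
  have hxmem : x ∈ closedNhd G {x} := subset_closedNhd _ (by simp)
  have hsub : ∀ r ∉ closedNhd G {x}, nearNhd G {x} r ⊆ (closedNhd G {x}).erase x := by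
    intro r hr v hv
    rw [mem_nearNhd] at hv
    refine Finset.mem_erase.2 ⟨?_, hv.1⟩
    rintro rfl
    exact notMem_of_adj hr hv.2.symm (by simp)
  have herase := Finset.card_erase_of_mem hxmem
  by_cases h8 : 8 ≤ Fintype.card V
  · obtain ⟨f, hfinj, hf⟩ := exists_numbering ({x} : Finset V)
    have := rvc_le_card_add_one (Fl := fun _ => False) (Finset.singleton_nonempty x)
      (connSet_singleton x) hfront hfinj hf ?_ ?_
    · rw [Finset.card_singleton] at this
      omega
    · intro r hr s hs hrs
      refine Or.inl ?_
      by_contra hadj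
      have hbound : ∀ r ∉ closedNhd G {x}, ∀ s ∉ closedNhd G {x}, r ≠ s → ¬ G.Adj r s →
          7 ≤ (nearNhd G {x} r).card + (closedNhd G {x})ᶜ.card := by
        intro r hr s hs hrs hadj
        have hf : farNhd G {x} r ⊆ ((closedNhd G {x})ᶜ.erase r).erase s := by
          intro v hv
          rw [mem_farNhd] at hv
          refine Finset.mem_erase.2 ⟨?_, Finset.mem_erase.2 ⟨hv.2.ne', Finset.mem_compl.2 hv.1⟩⟩
          rintro rfl
          exact hadj hv.2
        have h1 := Finset.card_le_card hf
        have hq : ({r, s} : Finset V).card ≤ (closedNhd G {x})ᶜ.card :=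
          Finset.card_le_card (by simp [Finset.insert_subset_iff, hr, hs])
        rw [Finset.card_pair hrs] at hq
        rw [Finset.card_erase_of_mem (Finset.mem_erase.2 ⟨hrs.symm, Finset.mem_compl.2 hs⟩),
          Finset.card_erase_of_mem (Finset.mem_compl.2 hr)] at h1
        have h2 := card_nearNhd_add_card_farNhd (G := G) {x} r
        have := hδ r
        omega
      have h1 := hbound r hr s hs hrs hadj
      have h2 := hbound s hs r hr hrs.symm fun h => hadj h.symm
      have h3 := Finset.card_le_card (Finset.union_subset (hsub r hr) (hsub s hs))
      rw [Finset.card_union_of_disjoint (disjoint_nearNhd hfront hr hs hrs)] at h3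
      omega
    · intro r hr
      have hne : (nearNhd G {x} r).Nonempty := by
        rw [← Finset.card_pos]
        have := card_nearNhd_add_card_farNhd (G := G) {x} r
        have := hδ r
        have := hfar r hr
        omega
      obtain ⟨m, hm⟩ := hne
      exact ⟨fun _ => ({x} : Finset V).card, by simp, ⟨m, hm, rfl⟩, False.elim⟩
  · obtain ⟨r, hr⟩ := hout
    have hq : 0 < (closedNhd G {x})ᶜ.card := Finset.card_pos.2 ⟨r, Finset.mem_compl.2 hr⟩
    have honly : ∀ s ∉ closedNhd G {x}, s = r := fun s hs =>
      Finset.card_le_one.1 (by omega) s (Finset.mem_compl.2 hs) r (Finset.mem_compl.2 hr)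
    have hfr : farNhd G {x} r = ∅ := by
      refine Finset.eq_empty_of_forall_notMem fun y hy => ?_
      rw [mem_farNhd] at hy
      exact hy.2.ne (honly y hy.1).symm
    have hnear := card_nearNhd_add_card_farNhd (G := G) {x} r
    rw [hfr, Finset.card_empty] at hnear
    have hr5 := hδ r
    have heq := Finset.eq_of_subset_of_card_le (hsub r hr) (by omega)
    have hclass : ∀ v, v = x ∨ v = r ∨ (G.Adj x v ∧ G.Adj r v) := by
      intro v
      by_cases hvx : v = x
      · exact Or.inl hvx
      by_cases hv : v ∈ closedNhd G {x}
      · refine Or.inr (Or.inr ⟨?_, ?_⟩)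
        · simpa [mem_closedNhd, hvx] using hv
        · have : v ∈ nearNhd G {x} r := by
            rw [heq]
            exact Finset.mem_erase.2 ⟨hvx, hv⟩
          exact (mem_nearNhd.1 this).2
      · exact Or.inr (Or.inl (honly v hv))
    obtain ⟨a, ha⟩ : (nearNhd G {x} r).Nonempty := Finset.card_pos.1 (by omega)
    have har := (mem_nearNhd.1 ha).2
    have hax : G.Adj x a := by
      rcases hclass a with rfl | rfl | h
      · exact absurd (hsub r hr ha) (by simp)
      · exact absurd rfl har.ne
      · exact h.1
    have := rvc_le_one (G := G) fun u v => ?_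
    · omega
    · rcases hclass u with rfl | rfl | hu <;> rcases hclass v with rfl | rfl | hv
      · exact Or.inl rfl
      · exact Or.inr (Or.inr ⟨a, hax, har.symm⟩)
      · exact Or.inr (Or.inl hv.1)
      · exact Or.inr (Or.inr ⟨a, har, hax.symm⟩)
      · exact Or.inl rfl
      · exact Or.inr (Or.inl hv.2)
      · exact Or.inr (Or.inl hu.1.symm)
      · exact Or.inr (Or.inl hu.2.symm)
      · exact Or.inr (Or.inr ⟨x, hu.1.symm, hv.1⟩)

theorem two_mul_rvc_add_four_le (hG : G.Connected)
    (hδ : ∀ v, 5 ≤ (Finset.univ.filter (G.Adj v)).card) :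
    2 * rvc G + 4 ≤ Fintype.card V := by
  obtain ⟨D, hD, hfront, hfar⟩ := exists_good hG hδ
  have hn := Finset.card_add_card_compl (closedNhd G D)
  have hle := hD.card_le
  by_cases hout : ∃ r, r ∉ closedNhd G D
  · by_cases hbig : 2 * D.card + 8 ≤ Fintype.card V
    · have := rvc_le_card_add_two hD.nonempty hD.conn hfront fun r hr => by
        have := card_nearNhd_add_card_farNhd (G := G) D r
        have := hδ r
        have := hfar r hr
        omega
      omega
    by_cases h2 : 2 ≤ D.card
    · exact two_mul_rvc_add_four_le_of_two_le hD hδ hfront hfar h2 (by omega)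
    · have hpos := hD.nonempty.card_pos
      obtain ⟨x, rfl⟩ := Finset.card_eq_one.1 (show D.card = 1 by omega)
      rw [Finset.card_singleton] at hbig
      exact two_mul_rvc_add_four_le_of_singleton hδ hfront hfar hout (by omega)
  · push Not at hout
    obtain ⟨f, hfinj, hf⟩ := exists_numbering D
    have := rvc_le_card hD.nonempty hD.conn hfront hfinj hf
      (fun r hr => absurd (hout r) hr) (fun r hr => absurd (hout r) hr)
    omega

end

end RainbowDomination

theorem stmt_14 {V : Type*} [Fintype V] (G : SimpleGraph V) [DecidableRel G.Adj]
    (hG : G.Connected) (hδ : G.minDegree = 5) :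
    (rvc G : ℝ) ≤ (Fintype.card V : ℝ) / 2 - 2 := by
  classical
  have h := RainbowDomination.two_mul_rvc_add_four_le hG fun v => by
    have hv := G.minDegree_le_degree v
    rw [hδ, ← G.card_neighborFinset_eq_degree, G.neighborFinset_eq_filter] at hv
    convert hv
  have h' : (2 * rvc G + 4 : ℝ) ≤ Fintype.card V := by exact_mod_cast h
  linarith
end
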